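/- arXiv:2405.15543 — 2 statements merged into one kernel-verified Lean document; each statement's English description precedes it below -/
import Mathlib

section
/- For every finite simple graph G, the following are equivalent: (1) G does not contain the house as an induced minor; (2) G does not contain an induced subdivision of the house and G does not contain an induced long twin wheel. -/
open SimpleGraph

/-! ### Minimal separators, tame and feral classes -/

/-- `S` separates `a` from `b` in `G`: `a, b` lie in distinct connected components of `G − S`,
i.e. every walk from `a` to `b` meets `S`. -/
def Separates {V : Type} (G : SimpleGraph V) (S : Set V) (a b : V) : Prop :=
  ∀ p : G.Walk a b, ∃ x ∈ p.support, x ∈ S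

/-- `S` is a minimal separator of `G`: some nonadjacent pair `a, b` outside `S` lies in distinct
components of `G − S`, while for every proper subset `S' ⊊ S` they lie in the same component
of `G − S'`. -/
def IsMinimalSeparator {V : Type} (G : SimpleGraph V) (S : Set V) : Prop :=
  ∃ a b : V, a ∉ S ∧ b ∉ S ∧ a ≠ b ∧ ¬ G.Adj a b ∧ Separates G S a b ∧
    ∀ S' : Set V, S' ⊂ S → ¬ Separates G S' a b

/-- The number of minimal separators of a graph on `Fin n`. -/
noncomputable def numMinSep {n : ℕ} (G : SimpleGraph (Fin n)) : ℕ :=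
  {S : Set (Fin n) | IsMinimalSeparator G S}.ncard

/-- A class of finite simple graphs (one collection for each number of vertices) is tame if
some polynomial bounds the number of minimal separators of all its members. -/
def Tame (𝒢 : ∀ n : ℕ, SimpleGraph (Fin n) → Prop) : Prop :=
  ∃ p : Polynomial ℕ, ∀ (n : ℕ) (G : SimpleGraph (Fin n)), 𝒢 n G → numMinSep G ≤ p.eval n

/-- A class of finite simple graphs is feral if for some real `c > 1` there are infinitely many
graphs `G` in the class with at least `c ^ |V(G)|` minimal separators. -/
def Feral (𝒢 : ∀ n : ℕ, SimpleGraph (Fin n) → Prop) : Prop :=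
  ∃ c : ℝ, 1 < c ∧ ∀ N : ℕ, ∃ n : ℕ, N ≤ n ∧
    ∃ G : SimpleGraph (Fin n), 𝒢 n G ∧ (c ^ n : ℝ) ≤ (numMinSep G : ℝ)

/-! ### Minors and induced minors via models -/

/-- An induced minor model of `H` in `G`. -/
def IsInducedMinorModel {V W : Type} (G : SimpleGraph V) (H : SimpleGraph W)
    (X : W → Set V) : Prop :=
  (∀ w, (X w).Nonempty) ∧
  (∀ w, (G.induce (X w)).Connected) ∧
  (Pairwise fun u w => Disjoint (X u) (X w)) ∧
  (∀ u w, H.Adj u w → ∃ a ∈ X u, ∃ b ∈ X w, G.Adj a b) ∧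
  (∀ u w, u ≠ w → ¬ H.Adj u w → ∀ a ∈ X u, ∀ b ∈ X w, ¬ G.Adj a b)

/-- `H` is an induced minor of `G`. -/
def InducedMinor {V W : Type} (H : SimpleGraph W) (G : SimpleGraph V) : Prop :=
  ∃ X : W → Set V, IsInducedMinorModel G H X

/-- A minor model of `H` in `G` (edges between branch sets of nonadjacent vertices allowed). -/
def IsMinorModel {V W : Type} (G : SimpleGraph V) (H : SimpleGraph W)
    (X : W → Set V) : Prop :=
  (∀ w, (X w).Nonempty) ∧
  (∀ w, (G.induce (X w)).Connected) ∧
  (Pairwise fun u w => Disjoint (X u) (X w)) ∧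
  (∀ u w, H.Adj u w → ∃ a ∈ X u, ∃ b ∈ X w, G.Adj a b)

/-- `H` is a minor of `G`. -/
def IsMinorOf {V W : Type} (H : SimpleGraph W) (G : SimpleGraph V) : Prop :=
  ∃ X : W → Set V, IsMinorModel G H X

/-! ### Subdivisions -/

/-- The graph obtained from `H` by subdividing the edge `uv`: the new vertex is `none`, it is
joined to `u` and `v`, the edge `uv` is removed and everything else is unchanged. -/
def subdivideEdge {W : Type} (H : SimpleGraph W) (u v : W) : SimpleGraph (Option W) :=
  SimpleGraph.fromRel fun x y =>
    (∃ a b : W, x = some a ∧ y = some b ∧ H.Adj a b ∧ ¬(a = u ∧ b = v) ∧ ¬(a = v ∧ b = u)) ∨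
    (x = none ∧ (y = some u ∨ y = some v))

/-- `Subdivision H H'` holds when `H'` is obtained from `H` by repeatedly subdividing edges. -/
inductive Subdivision : {A : Type} → SimpleGraph A → {B : Type} → SimpleGraph B → Prop where
  | refl {A : Type} (G : SimpleGraph A) : Subdivision G G
  | step {A : Type} {G : SimpleGraph A} {B : Type} {H : SimpleGraph B} {u v : B} :
      Subdivision G H → H.Adj u v → Subdivision G (subdivideEdge H u v)

/-- `G` contains an induced subdivision of `H`, i.e. `H` is an induced topological minor
of `G`: some subdivision of `H` is isomorphic to an induced subgraph of `G`. -/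
def ContainsInducedSubdivision {A V : Type} (H : SimpleGraph A) (G : SimpleGraph V) : Prop :=
  ∃ (B : Type) (H' : SimpleGraph B), Subdivision H H' ∧ Nonempty (H' ↪g G)

/-! ### Particular graphs -/

/-- `2P₂`: the disjoint union of two edges. -/
def twoP2 : SimpleGraph (Fin 4) :=
  SimpleGraph.fromRel fun v w => (v = 0 ∧ w = 1) ∨ (v = 2 ∧ w = 3)

/-- The diamond: `K₄` minus the edge `03`. -/
def diamond : SimpleGraph (Fin 4) :=
  SimpleGraph.fromRel fun v w => ¬(v = 0 ∧ w = 3) ∧ ¬(v = 3 ∧ w = 0)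

/-- The butterfly: two triangles `{0,1,2}` and `{0,3,4}` sharing the vertex `0`. -/
def butterfly : SimpleGraph (Fin 5) :=
  SimpleGraph.fromRel fun v w =>
    (v = 0 ∧ w = 1) ∨ (v = 0 ∧ w = 2) ∨ (v = 1 ∧ w = 2) ∨
    (v = 0 ∧ w = 3) ∨ (v = 0 ∧ w = 4) ∨ (v = 3 ∧ w = 4)

/-- The house: the `5`-cycle `0-1-2-3-4-0` together with the chord `03`. -/
def house : SimpleGraph (Fin 5) :=
  SimpleGraph.fromRel fun v w =>
    (v = 0 ∧ w = 1) ∨ (v = 1 ∧ w = 2) ∨ (v = 2 ∧ w = 3) ∨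
    (v = 3 ∧ w = 4) ∨ (v = 0 ∧ w = 4) ∨ (v = 0 ∧ w = 3)

/-- `K₃ + P₁`: a triangle together with an isolated vertex. -/
def k3PlusP1 : SimpleGraph (Fin 4) :=
  SimpleGraph.fromRel fun v w => (v = 0 ∧ w = 1) ∨ (v = 0 ∧ w = 2) ∨ (v = 1 ∧ w = 2)

/-- The (short) `k`-theta: vertices `a = inl 0`, `b = inl 1`, `aᵢ = inr (i, 0)`,
`bᵢ = inr (i, 1)`, with edges `a aᵢ`, `aᵢ bᵢ`, `bᵢ b`. -/
def thetaGraph (k : ℕ) : SimpleGraph (Fin 2 ⊕ Fin k × Fin 2) :=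
  SimpleGraph.fromRel fun v w =>
    (∃ i, v = Sum.inl 0 ∧ w = Sum.inr (i, 0)) ∨
    (∃ i, v = Sum.inl 1 ∧ w = Sum.inr (i, 1)) ∨
    (∃ i, v = Sum.inr (i, 0) ∧ w = Sum.inr (i, 1))

/-- The (short) `k`-prism: two `k`-cliques `{(i,0)}` and `{(i,1)}` with a perfect matching. -/
def prismGraph (k : ℕ) : SimpleGraph (Fin k × Fin 2) :=
  SimpleGraph.fromRel fun v w => (v.2 = w.2 ∧ v.1 ≠ w.1) ∨ (v.1 = w.1 ∧ v.2 ≠ w.2)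

/-- The `k`-skinny ladder: paths `p_i = (i,0)`, `q_i = (i,1)`, independent set `r_i = (i,2)`,
with edges `p_i p_{i+1}`, `q_i q_{i+1}`, `p_i r_i`, `q_i r_i`. -/
def skinnyLadder (k : ℕ) : SimpleGraph (Fin k × Fin 3) :=
  SimpleGraph.fromRel fun v w =>
    (v.2 = w.2 ∧ v.2 ≠ 2 ∧ w.1.val = v.1.val + 1) ∨
    (v.1 = w.1 ∧ v.2 ≠ 2 ∧ w.2 = 2)

/-- `gammaGraph p q r` is the graph `Γ` consisting of two vertices `a = inl 0` and `b = inl 1`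
joined by three internally disjoint paths with `p`, `q`, `r` internal vertices respectively
(so of lengths `p+1`, `q+1`, `r+1`); i.e. `Γ_{p+1, q+1, r+1}`. -/
def gammaGraph (p q r : ℕ) : SimpleGraph (Fin 2 ⊕ (Fin p ⊕ (Fin q ⊕ Fin r))) :=
  SimpleGraph.fromRel fun v w =>
    match v, w with
    | Sum.inl x, Sum.inl y => x = 0 ∧ y = 1 ∧ (p = 0 ∨ q = 0 ∨ r = 0)
    | Sum.inl x, Sum.inr (Sum.inl t) => (x = 0 ∧ t.val = 0) ∨ (x = 1 ∧ t.val = p - 1)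
    | Sum.inl x, Sum.inr (Sum.inr (Sum.inl t)) => (x = 0 ∧ t.val = 0) ∨ (x = 1 ∧ t.val = q - 1)
    | Sum.inl x, Sum.inr (Sum.inr (Sum.inr t)) => (x = 0 ∧ t.val = 0) ∨ (x = 1 ∧ t.val = r - 1)
    | Sum.inr (Sum.inl t), Sum.inr (Sum.inl s) => s.val = t.val + 1
    | Sum.inr (Sum.inr (Sum.inl t)), Sum.inr (Sum.inr (Sum.inl s)) => s.val = t.val + 1
    | Sum.inr (Sum.inr (Sum.inr t)), Sum.inr (Sum.inr (Sum.inr s)) => s.val = t.val + 1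
    | _, _ => False

/-- The long twin wheel on a cycle of length `n`: the cycle `0-1-⋯-(n-1)-0` on `Fin n`
together with a center adjacent exactly to the consecutive vertices `0`, `1`, `2`. -/
def longTwinWheel (n : ℕ) : SimpleGraph (Fin n ⊕ Unit) :=
  SimpleGraph.fromRel fun v w =>
    match v, w with
    | Sum.inl a, Sum.inl b => b.val = a.val + 1 ∨ (a.val = n - 1 ∧ b.val = 0)
    | Sum.inl a, Sum.inr _ => a.val = 0 ∨ a.val = 1 ∨ a.val = 2
    | _, _ => False

/-! ### Thin walks -/

/-- A thin walk in `H`: a walk whose vertices are pairwise distinct except that possibly the two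
endpoints coincide, and all of whose internal vertices have degree `2` in `H`. -/
def IsThinWalk {V : Type} (H : SimpleGraph V) {x y : V} (p : H.Walk x y) : Prop :=
  p.support.tail.Nodup ∧ p.support.dropLast.Nodup ∧
    ∀ v ∈ p.support.tail.dropLast, (H.neighborSet v).ncard = 2

/-! ### Creatures -/

/-- A `k`-creature in `G` on the pairwise disjoint nonempty vertex sets `A`, `B`, `X`, `Y`. -/
def IsCreature {V : Type} (G : SimpleGraph V) (k : ℕ) (A B X Y : Set V) : Prop :=
  A.Nonempty ∧ B.Nonempty ∧
  Disjoint A B ∧ Disjoint A X ∧ Disjoint A Y ∧ Disjoint B X ∧ Disjoint B Y ∧ Disjoint X Y ∧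
  (G.induce A).Connected ∧ (G.induce B).Connected ∧
  (∀ a ∈ A, ∀ b ∈ B, ¬ G.Adj a b) ∧
  (∀ a ∈ A, ∀ y ∈ Y, ¬ G.Adj a y) ∧
  (∀ b ∈ B, ∀ x ∈ X, ¬ G.Adj b x) ∧
  (∀ x ∈ X, ∃ a ∈ A, G.Adj x a) ∧
  (∀ y ∈ Y, ∃ b ∈ B, G.Adj y b) ∧
  ∃ (x : Fin k → V) (y : Fin k → V), Function.Injective x ∧ Function.Injective y ∧
    X = Set.range x ∧ Y = Set.range y ∧ ∀ i j, G.Adj (x i) (y j) ↔ i = j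

/-- `G` is `k`-creature-free. -/
def CreatureFree {V : Type} (G : SimpleGraph V) (k : ℕ) : Prop :=
  ¬ ∃ A B X Y : Set V, IsCreature G k A B X Y

/-! ### Distance to minor-closed classes, feedback vertex set number -/

/-- `cFam F G`: the least size of a vertex set `S` such that `G − S` has no minor isomorphic
to a member of the family `F`. -/
noncomputable def cFam {V : Type} (F : ∀ n : ℕ, SimpleGraph (Fin n) → Prop)
    (G : SimpleGraph V) : ℕ :=
  sInf {k | ∃ S : Set V, S.ncard = k ∧
    ∀ (n : ℕ) (H : SimpleGraph (Fin n)), F n H → ¬ IsMinorOf H (G.induce Sᶜ)}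

/-- The feedback vertex set number of `G`. -/
noncomputable def fvs {V : Type} (G : SimpleGraph V) : ℕ :=
  sInf {k | ∃ S : Set V, S.ncard = k ∧ (G.induce Sᶜ).IsAcyclic}

/-! ### Long unichords and long thetas -/

/-- `G` has a long unichord: an edge which is the unique chord of some cycle of length ≥ 5. -/
def HasLongUnichord {V : Type} (G : SimpleGraph V) : Prop :=
  ∃ (v : V) (c : G.Walk v v), c.IsCycle ∧ 5 ≤ c.length ∧
    ∃ a b : V, a ∈ c.support ∧ b ∈ c.support ∧ G.Adj a b ∧ s(a, b) ∉ c.edges ∧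
      ∀ x y : V, x ∈ c.support → y ∈ c.support → G.Adj x y → s(x, y) ∉ c.edges →
        s(x, y) = s(a, b)

/-- `G` is long-theta-free: no induced subgraph of `G` is a theta `Γ_{i,j,k}` with
`i, j, k ≥ 2` and at least one of `i, j, k` at least `3`. -/
def LongThetaFree {V : Type} (G : SimpleGraph V) : Prop :=
  ¬ ∃ i j k : ℕ, 2 ≤ i ∧ 2 ≤ j ∧ 2 ≤ k ∧ (3 ≤ i ∨ 3 ≤ j ∨ 3 ≤ k) ∧
    Nonempty (gammaGraph (i - 1) (j - 1) (k - 1) ↪g G)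


/-! ### Connected vertex sets -/

/-- A nonempty vertex set `S` such that every subset of `S` that is closed under adjacency inside
`S` and nonempty is all of `S`. -/
def IsConnSet {V : Type} (G : SimpleGraph V) (S : Set V) : Prop :=
  S.Nonempty ∧ ∀ T : Set V, (∃ a ∈ S, a ∈ T) →
    (∀ a ∈ S, a ∈ T → ∀ b ∈ S, G.Adj a b → b ∈ T) → S ⊆ T

theorem isConnSet_iff_connected {V : Type} (G : SimpleGraph V) (S : Set V) :
    IsConnSet G S ↔ (G.induce S).Connected := by
  constructor
  · rintro ⟨⟨s, hs⟩, h⟩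
    rw [connected_iff_exists_forall_reachable]
    refine ⟨⟨s, hs⟩, fun w => ?_⟩
    have := h {x | ∃ hx : x ∈ S, (G.induce S).Reachable ⟨s, hs⟩ ⟨x, hx⟩}
      ⟨s, hs, hs, Reachable.refl _⟩ (by
        rintro a ha ⟨_, hr⟩ b hb hab
        exact ⟨hb, hr.trans (Adj.reachable (by simpa using hab))⟩) w.2
    exact this.2
  · intro h
    obtain ⟨⟨s, hs⟩⟩ := h.nonempty
    refine ⟨⟨s, hs⟩, ?_⟩
    rintro T ⟨a, ha, haT⟩ hT b hb
    obtain ⟨p⟩ := h.preconnected ⟨a, ha⟩ ⟨b, hb⟩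
    have key : ∀ (x y : S), (G.induce S).Walk x y → x.1 ∈ T → y.1 ∈ T := by
      intro x y p
      induction p with
      | nil => exact id
      | cons hadj _ ih => exact fun hx => ih (hT _ (Subtype.prop _) hx _ (Subtype.prop _) (by simpa using hadj))
    exact key _ _ p haT

theorem IsConnSet.singleton {V : Type} (G : SimpleGraph V) (v : V) : IsConnSet G {v} := by
  refine ⟨⟨v, rfl⟩, ?_⟩
  rintro T ⟨a, rfl, ha⟩ _ x rfl
  exact ha

theorem IsConnSet.insert {V : Type} {G : SimpleGraph V} {S : Set V} (h : IsConnSet G S)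
    {x y : V} (hy : y ∈ S) (hxy : G.Adj x y) : IsConnSet G (insert x S) := by
  refine ⟨⟨x, by simp⟩, ?_⟩
  intro T hT hcl
  have h1 : S ⊆ T := by
    apply h.2 T
    · obtain ⟨a, ha, haT⟩ := hT
      rcases ha with rfl | ha
      · exact ⟨y, hy, hcl _ (by simp) haT _ (by simp [hy]) hxy⟩
      · exact ⟨a, ha, haT⟩
    · intro a ha haT b hb hab
      exact hcl a (by simp [ha]) haT b (by simp [hb]) hab
  rintro z (rfl | hz)
  · exact hcl y (by simp [hy]) (h1 hy) _ (by simp) hxy.symm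
  · exact h1 hz

theorem IsConnSet.image {V W : Type} {G : SimpleGraph V} {H : SimpleGraph W} {S : Set V}
    (h : IsConnSet G S) {f : V → W} (hf : ∀ a ∈ S, ∀ b ∈ S, G.Adj a b → H.Adj (f a) (f b)) :
    IsConnSet H (f '' S) := by
  refine ⟨h.1.image f, ?_⟩
  rintro T ⟨_, ⟨a, ha, rfl⟩, haT⟩ hcl _ ⟨b, hb, rfl⟩
  refine h.2 (f ⁻¹' T) ⟨a, ha, haT⟩ ?_ hb
  intro x hx hxT y hy hxy
  exact hcl _ ⟨x, hx, rfl⟩ hxT _ ⟨y, hy, rfl⟩ (hf x hx y hy hxy)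

theorem IsConnSet.exists_seq {V : Type} {G : SimpleGraph V} {S : Set V} (h : IsConnSet G S)
    {u w : V} (hu : u ∈ S) (hw : w ∈ S) :
    ∃ (l : ℕ) (g : ℕ → V), g 0 = u ∧ g l = w ∧ (∀ k ≤ l, g k ∈ S) ∧
      ∀ k < l, G.Adj (g k) (g (k + 1)) := by
  refine h.2 {w | ∃ (l : ℕ) (g : ℕ → V), g 0 = u ∧ g l = w ∧ (∀ k ≤ l, g k ∈ S) ∧
      ∀ k < l, G.Adj (g k) (g (k + 1))} ⟨u, hu, 0, fun _ => u, rfl, rfl, ?_, ?_⟩ ?_ hw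
  · intros; exact hu
  · intro k hk; omega
  · rintro a ha ⟨l, g, h0, hl, hS, hadj⟩ b hb hab
    refine ⟨l + 1, fun k => if k ≤ l then g k else b, by simp [h0], by simp, ?_, ?_⟩
    · intro k _
      by_cases hk : k ≤ l
      · simpa [hk] using hS k hk
      · simpa [hk] using hb
    · intro k hk
      by_cases hk' : k < l
      · simpa [hk', hk'.le, Nat.succ_le_iff] using hadj k hk'
      · obtain rfl : k = l := by omega
        simpa [hl] using hab

theorem isConnSet_interval {V : Type} {G : SimpleGraph V} (f : ℕ → V) (m n : ℕ) (hmn : m ≤ n)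
    (hf : ∀ k, m ≤ k → k < n → G.Adj (f k) (f (k + 1))) :
    IsConnSet G {x | ∃ k, m ≤ k ∧ k ≤ n ∧ x = f k} := by
  induction n, hmn using Nat.le_induction with
  | base =>
    convert IsConnSet.singleton G (f m) using 1
    ext x
    constructor
    · rintro ⟨k, h1, h2, rfl⟩
      obtain rfl : k = m := by omega
      rfl
    · rintro rfl
      exact ⟨m, le_rfl, le_rfl, rfl⟩
  | succ n hmn ih =>
    have := (ih fun k h1 h2 => hf k h1 (by omega)).insert (x := f (n + 1)) (y := f n)
      ⟨n, hmn, le_rfl, rfl⟩ (hf n hmn (by omega)).symm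
    convert this using 1
    ext x
    constructor
    · rintro ⟨k, h1, h2, rfl⟩
      by_cases hk : k = n + 1
      · left; rw [hk]
      · right; exact ⟨k, h1, by omega, rfl⟩
    · rintro (rfl | ⟨k, h1, h2, rfl⟩)
      · exact ⟨n + 1, by omega, le_rfl, rfl⟩
      · exact ⟨k, h1, by omega, rfl⟩

/-! ### Induced minors of subdivisions and long twin wheels -/

theorem InducedMinor.of_embedding {U V W : Type} {H : SimpleGraph W} {G' : SimpleGraph U}
    {G : SimpleGraph V} (h : InducedMinor H G') (e : G' ↪g G) : InducedMinor H G := by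
  obtain ⟨X, h1, h2, h3, h4, h5⟩ := h
  refine ⟨fun w => e '' X w, fun w => (h1 w).image e, fun w => ?_, ?_, ?_, ?_⟩
  · rw [← isConnSet_iff_connected]
    exact ((isConnSet_iff_connected _ _).2 (h2 w)).image fun a _ b _ hab => e.map_adj_iff.2 hab
  · intro u w huw
    exact (Set.disjoint_image_iff e.injective).2 (h3 huw)
  · intro u w huw
    obtain ⟨a, ha, b, hb, hab⟩ := h4 u w huw
    exact ⟨e a, ⟨a, ha, rfl⟩, e b, ⟨b, hb, rfl⟩, e.map_adj_iff.2 hab⟩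
  · rintro u w huw hn _ ⟨a, ha, rfl⟩ _ ⟨b, hb, rfl⟩
    rw [e.map_adj_iff]
    exact h5 u w huw hn a ha b hb

theorem InducedMinor.refl {W : Type} (H : SimpleGraph W) : InducedMinor H H := by
  refine ⟨fun w => {w}, fun w => ⟨w, rfl⟩, fun w => ?_, ?_, ?_, ?_⟩
  · rw [← isConnSet_iff_connected]
    exact IsConnSet.singleton H w
  · intro u w huw
    simpa using huw
  · intro u w huw
    exact ⟨u, rfl, w, rfl, huw⟩
  · rintro u w _ hn _ rfl _ rfl
    exact hn

theorem subdivideEdge_adj_some {W : Type} (H : SimpleGraph W) (u v a b : W) :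
    (subdivideEdge H u v).Adj (some a) (some b) ↔
      H.Adj a b ∧ ¬(a = u ∧ b = v) ∧ ¬(a = v ∧ b = u) := by
  simp only [subdivideEdge, fromRel_adj]
  constructor
  · rintro ⟨_, (⟨a', b', h1, h2, h3⟩ | h) | (⟨a', b', h1, h2, h3⟩ | h)⟩
    · cases h1; cases h2; exact h3
    · simp at h
    · cases h1; cases h2; exact ⟨h3.1.symm, by tauto⟩
    · simp at h
  · intro h
    exact ⟨by simpa using h.1.ne, Or.inl (Or.inl ⟨a, b, rfl, rfl, h⟩)⟩

theorem subdivideEdge_adj_none {W : Type} (H : SimpleGraph W) (u v a : W) :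
    (subdivideEdge H u v).Adj none (some a) ↔ a = u ∨ a = v := by
  simp [subdivideEdge, fromRel_adj]

theorem InducedMinor.subdivideEdge {U W : Type} {K : SimpleGraph U} {H : SimpleGraph W}
    (h : InducedMinor K H) {u v : W} (huv : H.Adj u v) :
    InducedMinor K (subdivideEdge H u v) := by
  obtain ⟨X, h1, h2, h3, h4, h5⟩ := h
  have hd : ∀ i j x, x ∈ X i → x ∈ X j → i = j := by
    intro i j x hi hj
    by_contra hij
    exact (Set.disjoint_left.1 (h3 hij) hi) hj
  have hnn : ¬ (_root_.subdivideEdge H u v).Adj none none := SimpleGraph.irrefl _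
  refine ⟨fun w => {x | (∃ y ∈ X w, x = some y) ∨ (x = none ∧ u ∈ X w)},
    fun w => ?_, fun w => ?_, ?_, ?_, ?_⟩
  · obtain ⟨y, hy⟩ := h1 w
    exact ⟨some y, Or.inl ⟨y, hy, rfl⟩⟩
  · have hw := (isConnSet_iff_connected _ _).2 (h2 w)
    rw [← isConnSet_iff_connected]
    refine ⟨by obtain ⟨y, hy⟩ := h1 w; exact ⟨some y, Or.inl ⟨y, hy, rfl⟩⟩, ?_⟩
    intro T hT hcl
    have hsub : X w ⊆ some ⁻¹' T := by
      apply hw.2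
      · obtain ⟨a, ⟨y, hy, rfl⟩ | ⟨rfl, hu⟩, haT⟩ := hT
        · exact ⟨y, hy, haT⟩
        · exact ⟨u, hu, hcl _ (Or.inr ⟨rfl, hu⟩) haT _ (Or.inl ⟨u, hu, rfl⟩)
            ((subdivideEdge_adj_none H u v u).2 (Or.inl rfl))⟩
      · intro a ha haT b hb hab
        by_cases hc : (a = u ∧ b = v) ∨ (a = v ∧ b = u)
        · have hu : u ∈ X w := by rcases hc with ⟨rfl, rfl⟩ | ⟨rfl, rfl⟩ <;> assumption
          have hn : none ∈ T := hcl (some a) (Or.inl ⟨a, ha, rfl⟩) haT none (Or.inr ⟨rfl, hu⟩)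
            ((subdivideEdge_adj_none H u v a).2 (by tauto)).symm
          exact hcl none (Or.inr ⟨rfl, hu⟩) hn _ (Or.inl ⟨b, hb, rfl⟩)
            ((subdivideEdge_adj_none H u v b).2 (by tauto))
        · exact hcl (some a) (Or.inl ⟨a, ha, rfl⟩) haT _ (Or.inl ⟨b, hb, rfl⟩)
            ((subdivideEdge_adj_some H u v a b).2 ⟨hab, by tauto⟩)
    rintro _ (⟨y, hy, rfl⟩ | ⟨rfl, hu⟩)
    · exact hsub hy
    · exact hcl (some u) (Or.inl ⟨u, hu, rfl⟩) (hsub hu) _ (Or.inr ⟨rfl, hu⟩)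
        ((subdivideEdge_adj_none H u v u).2 (Or.inl rfl)).symm
  · intro i j hij
    rw [Set.disjoint_left]
    rintro _ (⟨y, hy, rfl⟩ | ⟨rfl, hu⟩) (⟨z, hz, h⟩ | ⟨h, hu'⟩)
    · cases h; exact hij (hd _ _ _ hy hz)
    · cases h
    · cases h
    · exact hij (hd _ _ _ hu hu')
  · intro i j hij
    obtain ⟨a, ha, b, hb, hab⟩ := h4 i j hij
    by_cases hc : (a = u ∧ b = v)
    · exact ⟨none, Or.inr ⟨rfl, hc.1 ▸ ha⟩, some b, Or.inl ⟨b, hb, rfl⟩,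
        (subdivideEdge_adj_none H u v b).2 (by tauto)⟩
    · by_cases hc' : (a = v ∧ b = u)
      · exact ⟨some a, Or.inl ⟨a, ha, rfl⟩, none, Or.inr ⟨rfl, hc'.2 ▸ hb⟩,
          ((subdivideEdge_adj_none H u v a).2 (by tauto)).symm⟩
      · exact ⟨some a, Or.inl ⟨a, ha, rfl⟩, some b, Or.inl ⟨b, hb, rfl⟩,
          (subdivideEdge_adj_some H u v a b).2 ⟨hab, hc, hc'⟩⟩
  · have key : ∀ i j, i ≠ j → ¬ K.Adj i j → u ∈ X i → ∀ z ∈ X j, ¬ (z = u ∨ z = v) := by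
      rintro i j hij hn hu z hz (rfl | rfl)
      · exact hij (hd _ _ _ hu hz)
      · exact h5 i j hij hn u hu _ hz huv
    rintro i j hij hn _ (⟨y, hy, rfl⟩ | ⟨rfl, hu⟩) _ (⟨z, hz, rfl⟩ | ⟨rfl, hu'⟩) hadj
    · exact h5 i j hij hn y hy z hz ((subdivideEdge_adj_some H u v y z).1 hadj).1
    · exact key j i hij.symm (fun h => hn h.symm) hu' y hy
        ((subdivideEdge_adj_none H u v y).1 hadj.symm)
    · exact key i j hij hn hu z hz ((subdivideEdge_adj_none H u v z).1 hadj)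
    · exact hnn hadj

theorem Subdivision.inducedMinor {A B : Type} {H : SimpleGraph A} {H' : SimpleGraph B}
    (h : Subdivision H H') : InducedMinor H H' := by
  induction h with
  | refl => exact InducedMinor.refl _
  | step _ huv ih => exact ih.subdivideEdge huv

theorem house_adj_iff (i j : Fin 5) : house.Adj i j ↔
    (i, j) ∈ ({(0, 1), (1, 0), (1, 2), (2, 1), (2, 3), (3, 2), (3, 4), (4, 3), (0, 4), (4, 0),
      (0, 3), (3, 0)} : Finset (Fin 5 × Fin 5)) := by
  simp only [house, fromRel_adj]
  revert i j
  decide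

theorem longTwinWheel_adj_inl {n : ℕ} (a b : Fin n) :
    (longTwinWheel n).Adj (Sum.inl a) (Sum.inl b) ↔ a ≠ b ∧
      ((b.val = a.val + 1 ∨ (a.val = n - 1 ∧ b.val = 0)) ∨
        (a.val = b.val + 1 ∨ (b.val = n - 1 ∧ a.val = 0))) := by
  simp [longTwinWheel, fromRel_adj]

theorem longTwinWheel_adj_inr {n : ℕ} (a : Fin n) (c : Unit) :
    (longTwinWheel n).Adj (Sum.inl a) (Sum.inr c) ↔ a.val = 0 ∨ a.val = 1 ∨ a.val = 2 := by
  simp [longTwinWheel, fromRel_adj]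

theorem longTwinWheel_inducedMinor_house {n : ℕ} (hn : 5 ≤ n) :
    InducedMinor house (longTwinWheel n) := by
  let h : ℕ → Fin n ⊕ Unit := fun k => Sum.inl ⟨k % n, Nat.mod_lt _ (by omega)⟩
  have hval : ∀ k < n, k % n = k := fun k hk => Nat.mod_eq_of_lt hk
  have hadj : ∀ k l, k < n → l < n → ((longTwinWheel n).Adj (h k) (h l) ↔
      k ≠ l ∧ ((l = k + 1 ∨ (k = n - 1 ∧ l = 0)) ∨ (k = l + 1 ∨ (l = n - 1 ∧ k = 0)))) := by
    intro k l hk hl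
    simp only [h, longTwinWheel_adj_inl, hval k hk, hval l hl, ne_eq, Fin.mk.injEq]
  have hadjc : ∀ k, k < n → ((longTwinWheel n).Adj (h k) (Sum.inr ()) ↔
      k = 0 ∨ k = 1 ∨ k = 2) := by
    intro k hk
    simp only [h, longTwinWheel_adj_inr, hval k hk]
  have hinj : ∀ k l, k < n → l < n → (h k = h l ↔ k = l) := by
    intro k l hk hl
    simp only [h, hval k hk, hval l hl, Sum.inl.injEq, Fin.mk.injEq]
  have hI : ∀ m l, m ≤ l → l < n → IsConnSet (longTwinWheel n) {x | ∃ k, m ≤ k ∧ k ≤ l ∧ x = h k} :=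
    fun m l hml hl => isConnSet_interval h m l hml fun k h1 h2 => by
      rw [hadj k (k + 1) (by omega) (by omega)]; omega
  let X : Fin 5 → Set (Fin n ⊕ Unit) := ![{x | ∃ k, 0 ≤ k ∧ k ≤ 0 ∧ x = h k},
    {x | ∃ k, 4 ≤ k ∧ k ≤ n - 1 ∧ x = h k}, {x | ∃ k, 3 ≤ k ∧ k ≤ 3 ∧ x = h k},
    {x | ∃ k, 1 ≤ k ∧ k ≤ 2 ∧ x = h k}, {Sum.inr ()}]
  have hconn : ∀ i, IsConnSet (longTwinWheel n) (X i) := by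
    intro i
    fin_cases i
    · exact hI 0 0 le_rfl (by omega)
    · exact hI 4 (n - 1) (by omega) (by omega)
    · exact hI 3 3 le_rfl (by omega)
    · exact hI 1 2 (by omega) (by omega)
    · exact IsConnSet.singleton _ _
  have hne : ∀ k, h k ≠ Sum.inr () := fun k => by simp [h]
  refine ⟨X, fun i => (hconn i).1, fun i => (isConnSet_iff_connected _ _).1 (hconn i), ?_, ?_, ?_⟩
  · intro i j hij
    rw [Set.disjoint_left]
    fin_cases i <;> fin_cases j <;> first | exact absurd rfl hij | skip
    all_goals
      simp only [X, Fin.reduceFinMk, Fin.isValue, Matrix.cons_val, Fin.zero_eta, Fin.mk_one,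
        Set.mem_ofPred_eq, Set.mem_singleton_iff, forall_exists_index, and_imp]
      rintro x
    all_goals first
      | rintro k h1 h2 rfl ⟨l, h3, h4, h5⟩
        rw [hinj k l (by omega) (by omega)] at h5
        omega
      | rintro k h1 h2 rfl h5
        exact hne k h5
      | rintro rfl ⟨l, h3, h4, h5⟩
        exact hne l h5.symm
  · have hsymm : ∀ i j, (∃ a ∈ X i, ∃ b ∈ X j, (longTwinWheel n).Adj a b) →
        ∃ a ∈ X j, ∃ b ∈ X i, (longTwinWheel n).Adj a b := by
      rintro i j ⟨a, ha, b, hb, hab⟩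
      exact ⟨b, hb, a, ha, hab.symm⟩
    have h01 : ∃ a ∈ X 0, ∃ b ∈ X 1, (longTwinWheel n).Adj a b :=
      ⟨h 0, ⟨0, by omega, by omega, rfl⟩, h (n - 1), ⟨n - 1, by omega, by omega, rfl⟩, by
        rw [hadj _ _ (by omega) (by omega)]; omega⟩
    have h12 : ∃ a ∈ X 1, ∃ b ∈ X 2, (longTwinWheel n).Adj a b :=
      ⟨h 4, ⟨4, by omega, by omega, rfl⟩, h 3, ⟨3, by omega, by omega, rfl⟩, by
        rw [hadj _ _ (by omega) (by omega)]; omega⟩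
    have h23 : ∃ a ∈ X 2, ∃ b ∈ X 3, (longTwinWheel n).Adj a b :=
      ⟨h 3, ⟨3, by omega, by omega, rfl⟩, h 2, ⟨2, by omega, by omega, rfl⟩, by
        rw [hadj _ _ (by omega) (by omega)]; omega⟩
    have h34 : ∃ a ∈ X 3, ∃ b ∈ X 4, (longTwinWheel n).Adj a b :=
      ⟨h 1, ⟨1, by omega, by omega, rfl⟩, Sum.inr (), rfl, by
        rw [hadjc _ (by omega)]; omega⟩
    have h04 : ∃ a ∈ X 0, ∃ b ∈ X 4, (longTwinWheel n).Adj a b :=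
      ⟨h 0, ⟨0, by omega, by omega, rfl⟩, Sum.inr (), rfl, by
        rw [hadjc _ (by omega)]; omega⟩
    have h03 : ∃ a ∈ X 0, ∃ b ∈ X 3, (longTwinWheel n).Adj a b :=
      ⟨h 0, ⟨0, by omega, by omega, rfl⟩, h 1, ⟨1, by omega, by omega, rfl⟩, by
        rw [hadj _ _ (by omega) (by omega)]; omega⟩
    intro i j hij
    rw [house_adj_iff] at hij
    simp only [Finset.mem_insert, Finset.mem_singleton, Prod.mk.injEq] at hij
    rcases hij with ⟨rfl, rfl⟩ | ⟨rfl, rfl⟩ | ⟨rfl, rfl⟩ | ⟨rfl, rfl⟩ | ⟨rfl, rfl⟩ | ⟨rfl, rfl⟩ |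
      ⟨rfl, rfl⟩ | ⟨rfl, rfl⟩ | ⟨rfl, rfl⟩ | ⟨rfl, rfl⟩ | ⟨rfl, rfl⟩ | ⟨rfl, rfl⟩ <;>
      first | assumption | (apply hsymm; assumption)
  · intro i j hij hn
    have hcases : (i = 0 ∧ j = 2) ∨ (i = 2 ∧ j = 0) ∨ (i = 1 ∧ j = 3) ∨ (i = 3 ∧ j = 1) ∨
        (i = 1 ∧ j = 4) ∨ (i = 4 ∧ j = 1) ∨ (i = 2 ∧ j = 4) ∨ (i = 4 ∧ j = 2) := by
      rw [house_adj_iff] at hn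
      revert i j
      decide
    clear hij hn
    rcases hcases with ⟨rfl, rfl⟩ | ⟨rfl, rfl⟩ | ⟨rfl, rfl⟩ | ⟨rfl, rfl⟩ | ⟨rfl, rfl⟩ | ⟨rfl, rfl⟩ |
      ⟨rfl, rfl⟩ | ⟨rfl, rfl⟩
    all_goals simp only [X, Fin.isValue, Matrix.cons_val, Set.mem_ofPred_eq, Set.mem_singleton_iff]
    all_goals first
      | rintro _ ⟨k, h1, h2, rfl⟩ _ ⟨l, h3, h4, rfl⟩
        rw [hadj k l (by omega) (by omega)]
        omega
      | rintro _ ⟨k, h1, h2, rfl⟩ _ rfl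
        rw [hadjc k (by omega)]
        omega
      | rintro _ rfl _ ⟨k, h1, h2, rfl⟩
        rw [SimpleGraph.adj_comm, hadjc k (by omega)]
        omega

/-! ### Subdivisions of the house as three paths between two vertices -/

/-- `G` is isomorphic to a subdivision of the house. -/
def IsHouseSubdivision {T : Type} (G : SimpleGraph T) : Prop :=
  ∃ (B : Type) (H' : SimpleGraph B), Subdivision house H' ∧ Nonempty (H' ≃g G)

theorem IsHouseSubdivision.of_iso {S T : Type} {G : SimpleGraph S} {G' : SimpleGraph T}
    (h : IsHouseSubdivision G) (e : G ≃g G') : IsHouseSubdivision G' := by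
  obtain ⟨B, H', hs, ⟨f⟩⟩ := h
  exact ⟨B, H', hs, ⟨f.trans e⟩⟩

theorem IsHouseSubdivision.subdivideEdge {T : Type} {G : SimpleGraph T}
    (h : IsHouseSubdivision G) {u v : T} (huv : G.Adj u v) :
    IsHouseSubdivision (subdivideEdge G u v) := by
  obtain ⟨B, H', hs, ⟨f⟩⟩ := h
  refine ⟨Option B, _root_.subdivideEdge H' (f.symm u) (f.symm v),
    hs.step (f.symm.map_adj_iff.2 huv), ⟨⟨Equiv.optionCongr f.toEquiv, ?_⟩⟩⟩
  rintro (_ | a) (_ | b)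
  · simp
  · simp [subdivideEdge_adj_none, RelIso.eq_symm_apply]
  · rw [SimpleGraph.adj_comm, SimpleGraph.adj_comm (_root_.subdivideEdge H' _ _)]
    simp [subdivideEdge_adj_none, RelIso.eq_symm_apply]
  · simp only [Equiv.optionCongr_apply, Option.map_some, subdivideEdge_adj_some,
      RelIso.eq_symm_apply, RelIso.coe_fn_toEquiv, f.map_adj_iff]

theorem isHouseSubdivision_house : IsHouseSubdivision house :=
  ⟨_, house, Subdivision.refl _, ⟨Iso.refl⟩⟩

theorem isHouseSubdivision_gammaGraph_zero : IsHouseSubdivision (gammaGraph 0 1 2) := by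
  let f : Fin 5 → Fin 2 ⊕ (Fin 0 ⊕ (Fin 1 ⊕ Fin 2)) :=
    ![Sum.inl 0, Sum.inr (Sum.inr (Sum.inr 0)), Sum.inr (Sum.inr (Sum.inr 1)), Sum.inl 1,
      Sum.inr (Sum.inr (Sum.inl 0))]
  have hf : Function.Bijective f := by decide
  refine isHouseSubdivision_house.of_iso ⟨Equiv.ofBijective f hf, ?_⟩
  intro a b
  rw [house_adj_iff]
  fin_cases a <;> fin_cases b <;> simp [f, gammaGraph, fromRel_adj]

theorem isHouseSubdivision_gammaGraph_rotate {p q r : ℕ}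
    (h : IsHouseSubdivision (gammaGraph p q r)) : IsHouseSubdivision (gammaGraph q r p) := by
  refine h.of_iso ⟨Equiv.sumCongr (Equiv.refl _)
    ((Equiv.sumComm _ _).trans (Equiv.sumAssoc _ _ _)), ?_⟩
  rintro (x | x | x | x) (y | y | y | y) <;>
    simp [gammaGraph, fromRel_adj]
  all_goals try tauto

/-- The inclusion of the vertices of `gammaGraph p q r` in those of `gammaGraph (p + 1) q r`,
extended by sending the new vertex to the last vertex of the longer path. -/
def gammaGraphSucc (p q r : ℕ) : Option (Fin 2 ⊕ (Fin p ⊕ (Fin q ⊕ Fin r))) →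
    Fin 2 ⊕ (Fin (p + 1) ⊕ (Fin q ⊕ Fin r))
  | none => Sum.inr (Sum.inl (Fin.last p))
  | some (Sum.inl x) => Sum.inl x
  | some (Sum.inr (Sum.inl t)) => Sum.inr (Sum.inl t.castSucc)
  | some (Sum.inr (Sum.inr y)) => Sum.inr (Sum.inr y)

theorem gammaGraphSucc_bijective (p q r : ℕ) : Function.Bijective (gammaGraphSucc p q r) := by
  constructor
  · rintro (_ | x | x | x) (_ | y | y | y) <;>
      simp [gammaGraphSucc, Fin.ext_iff]
    · exact y.2.ne'
    · exact x.2.ne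
  · rintro (x | x | x)
    · exact ⟨some (Sum.inl x), rfl⟩
    · by_cases hx : x.val < p
      · exact ⟨some (Sum.inr (Sum.inl ⟨x, hx⟩)), rfl⟩
      · refine ⟨none, ?_⟩
        simp only [gammaGraphSucc, Sum.inr.injEq, Sum.inl.injEq, Fin.ext_iff, Fin.val_last]
        omega
    · exact ⟨some (Sum.inr (Sum.inr x)), rfl⟩

theorem isHouseSubdivision_gammaGraph_one {q r : ℕ} (hq : 1 ≤ q) (hr : 1 ≤ r)
    (h : IsHouseSubdivision (gammaGraph 0 q r)) : IsHouseSubdivision (gammaGraph 1 q r) := by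
  have hq0 : q ≠ 0 := by omega
  have hr0 : r ≠ 0 := by omega
  have hadj : (gammaGraph 0 q r).Adj (Sum.inl 0) (Sum.inl 1) := by
    simp [gammaGraph, fromRel_adj]
  refine (h.subdivideEdge hadj).of_iso
    ⟨Equiv.ofBijective _ (gammaGraphSucc_bijective 0 q r), ?_⟩
  have hsome : ∀ x y, (gammaGraph 1 q r).Adj (gammaGraphSucc 0 q r (some x))
      (gammaGraphSucc 0 q r (some y)) ↔
      (gammaGraph 0 q r).Adj x y ∧ ¬(x = Sum.inl 0 ∧ y = Sum.inl 1) ∧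
        ¬(x = Sum.inl 1 ∧ y = Sum.inl 0) := by
    rintro (x | x | x | x) (y | y | y | y) <;>
      simp [gammaGraphSucc, gammaGraph, fromRel_adj, hq0, hr0]
    all_goals try omega
  have hnone : ∀ y, (gammaGraph 1 q r).Adj (gammaGraphSucc 0 q r none)
      (gammaGraphSucc 0 q r (some y)) ↔ y = Sum.inl 0 ∨ y = Sum.inl 1 := by
    rintro (y | y | y | y) <;>
      simp [gammaGraphSucc, gammaGraph, fromRel_adj]
  rintro (_ | x) (_ | y)
  · simp
  · rw [subdivideEdge_adj_none]
    exact hnone y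
  · rw [SimpleGraph.adj_comm, SimpleGraph.adj_comm (subdivideEdge _ _ _), subdivideEdge_adj_none]
    exact hnone x
  · rw [subdivideEdge_adj_some]
    exact hsome x y

theorem isHouseSubdivision_gammaGraph_succ_succ {p q r : ℕ}
    (h : IsHouseSubdivision (gammaGraph (p + 1) q r)) :
    IsHouseSubdivision (gammaGraph (p + 2) q r) := by
  have hadj : (gammaGraph (p + 1) q r).Adj (Sum.inr (Sum.inl (Fin.last p))) (Sum.inl 1) := by
    simp [gammaGraph, fromRel_adj]
  refine (h.subdivideEdge hadj).of_iso
    ⟨Equiv.ofBijective _ (gammaGraphSucc_bijective (p + 1) q r), ?_⟩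
  have hsome : ∀ x y, (gammaGraph (p + 2) q r).Adj (gammaGraphSucc (p + 1) q r (some x))
      (gammaGraphSucc (p + 1) q r (some y)) ↔
      (gammaGraph (p + 1) q r).Adj x y ∧ ¬(x = Sum.inr (Sum.inl (Fin.last p)) ∧ y = Sum.inl 1) ∧
        ¬(x = Sum.inl 1 ∧ y = Sum.inr (Sum.inl (Fin.last p))) := by
    rintro (x | x | x | x) (y | y | y | y) <;>
      simp [gammaGraphSucc, gammaGraph, fromRel_adj]
    all_goals first | omega | (simp only [Fin.ext_iff, Fin.val_last]; omega)
  have hnone : ∀ y, (gammaGraph (p + 2) q r).Adj (gammaGraphSucc (p + 1) q r none)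
      (gammaGraphSucc (p + 1) q r (some y)) ↔
        y = Sum.inr (Sum.inl (Fin.last p)) ∨ y = Sum.inl 1 := by
    rintro (y | y | y | y) <;>
      simp [gammaGraphSucc, gammaGraph, fromRel_adj]
    all_goals first | omega | (simp only [Fin.ext_iff, Fin.val_last, Fin.val_castSucc]; omega)
  rintro (_ | x) (_ | y)
  · simp
  · rw [subdivideEdge_adj_none]
    exact hnone y
  · rw [SimpleGraph.adj_comm, SimpleGraph.adj_comm (subdivideEdge _ _ _), subdivideEdge_adj_none]
    exact hnone x
  · rw [subdivideEdge_adj_some]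
    exact hsome x y

theorem isHouseSubdivision_gammaGraph (p q r : ℕ) :
    IsHouseSubdivision (gammaGraph p (q + 1) (r + 2)) := by
  have hr : ∀ r, IsHouseSubdivision (gammaGraph 0 1 (r + 2)) := by
    intro r
    induction r with
    | zero => exact isHouseSubdivision_gammaGraph_zero
    | succ r ih =>
      exact isHouseSubdivision_gammaGraph_rotate (isHouseSubdivision_gammaGraph_succ_succ
        (isHouseSubdivision_gammaGraph_rotate (isHouseSubdivision_gammaGraph_rotate ih)))
  have hq : ∀ q, IsHouseSubdivision (gammaGraph 0 (q + 1) (r + 2)) := by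
    intro q
    induction q with
    | zero => exact hr r
    | succ q ih =>
      exact isHouseSubdivision_gammaGraph_rotate (isHouseSubdivision_gammaGraph_rotate
        (isHouseSubdivision_gammaGraph_succ_succ (isHouseSubdivision_gammaGraph_rotate ih)))
  induction p with
  | zero => exact hq q
  | succ p ih =>
    cases p with
    | zero => exact isHouseSubdivision_gammaGraph_one (by omega) (by omega) ih
    | succ p => exact isHouseSubdivision_gammaGraph_succ_succ ih

/-! ### Holes with a connected set attached away from an edge -/

/-- `C` induces a cycle through the edge `pq`, and `K` is a connected set disjoint from `C`, with
no neighbor in `{p, q}`, such that `a` and `b` are distinct vertices of `C` with a neighbor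
in `K`. -/
structure IsAttachedHole {V : Type} (G : SimpleGraph V) (C K : Set V) (p q a b : V) : Prop where
  conn : IsConnSet G C
  regular : ∀ x ∈ C, ∃ y ∈ C, ∃ z ∈ C, y ≠ z ∧ G.Adj x y ∧ G.Adj x z ∧
    ∀ t ∈ C, G.Adj x t → t = y ∨ t = z
  conn_right : IsConnSet G K
  disjoint : ∀ x ∈ C, x ∉ K
  mem_p : p ∈ C
  mem_q : q ∈ C
  adj : G.Adj p q
  not_adj_p : ∀ k ∈ K, ¬ G.Adj p k
  not_adj_q : ∀ k ∈ K, ¬ G.Adj q k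
  mem_a : a ∈ C
  mem_b : b ∈ C
  ne : a ≠ b
  adj_a : ∃ k ∈ K, G.Adj a k
  adj_b : ∃ k ∈ K, G.Adj b k

/-- Some hole of `G` has a connected set attached to it away from an edge. -/
def HasAttachedHole {V : Type} (G : SimpleGraph V) : Prop :=
  ∃ (C K : Set V) (p q a b : V), IsAttachedHole G C K p q a b

theorem IsConnSet.congr {V : Type} {G H : SimpleGraph V} {S : Set V} (h : IsConnSet G S)
    (hf : ∀ a ∈ S, ∀ b ∈ S, G.Adj a b → H.Adj a b) : IsConnSet H S := by
  simpa using h.image (f := id) hf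

theorem IsAttachedHole.image {V W : Type} {G : SimpleGraph V} {H : SimpleGraph W}
    {C K : Set V} {p q a b : V} (h : IsAttachedHole G C K p q a b) (f : V → W)
    (hinj : Function.Injective f)
    (hf : ∀ x ∈ C ∪ K, ∀ y ∈ C ∪ K, (G.Adj x y ↔ H.Adj (f x) (f y))) :
    IsAttachedHole H (f '' C) (f '' K) (f p) (f q) (f a) (f b) where
  conn := h.conn.image fun x hx y hy => (hf x (Or.inl hx) y (Or.inl hy)).1
  regular := by
    rintro _ ⟨x, hx, rfl⟩
    obtain ⟨y, hy, z, hz, hyz, hxy, hxz, ht⟩ := h.regular x hx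
    refine ⟨_, ⟨y, hy, rfl⟩, _, ⟨z, hz, rfl⟩, fun e => hyz (hinj e),
      (hf _ (Or.inl hx) _ (Or.inl hy)).1 hxy, (hf _ (Or.inl hx) _ (Or.inl hz)).1 hxz, ?_⟩
    rintro _ ⟨t, htC, rfl⟩ hxt
    rcases ht t htC ((hf _ (Or.inl hx) _ (Or.inl htC)).2 hxt) with rfl | rfl
    · exact Or.inl rfl
    · exact Or.inr rfl
  conn_right := h.conn_right.image fun x hx y hy => (hf x (Or.inr hx) y (Or.inr hy)).1
  disjoint := by
    rintro _ ⟨x, hx, rfl⟩ ⟨y, hy, e⟩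
    exact h.disjoint x hx (hinj e ▸ hy)
  mem_p := ⟨p, h.mem_p, rfl⟩
  mem_q := ⟨q, h.mem_q, rfl⟩
  adj := (hf _ (Or.inl h.mem_p) _ (Or.inl h.mem_q)).1 h.adj
  not_adj_p := by
    rintro _ ⟨k, hk, rfl⟩ hadj
    exact h.not_adj_p k hk ((hf _ (Or.inl h.mem_p) _ (Or.inr hk)).2 hadj)
  not_adj_q := by
    rintro _ ⟨k, hk, rfl⟩ hadj
    exact h.not_adj_q k hk ((hf _ (Or.inl h.mem_q) _ (Or.inr hk)).2 hadj)
  mem_a := ⟨a, h.mem_a, rfl⟩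
  mem_b := ⟨b, h.mem_b, rfl⟩
  ne := fun e => h.ne (hinj e)
  adj_a := by
    obtain ⟨k, hk, hak⟩ := h.adj_a
    exact ⟨_, ⟨k, hk, rfl⟩, (hf _ (Or.inl h.mem_a) _ (Or.inr hk)).1 hak⟩
  adj_b := by
    obtain ⟨k, hk, hbk⟩ := h.adj_b
    exact ⟨_, ⟨k, hk, rfl⟩, (hf _ (Or.inl h.mem_b) _ (Or.inr hk)).1 hbk⟩

/-- The contraction of the edge `uv` onto `u`, keeping `v` as an isolated vertex. -/
def contractEdge {V : Type} (G : SimpleGraph V) (u v : V) : SimpleGraph V where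
  Adj a b := a ≠ b ∧ a ≠ v ∧ b ≠ v ∧ (G.Adj a b ∨ (a = u ∧ G.Adj v b) ∨ (b = u ∧ G.Adj a v))
  symm := ⟨by
    rintro a b ⟨h1, h2, h3, h4⟩
    refine ⟨h1.symm, h3, h2, ?_⟩
    rcases h4 with h | ⟨h, h'⟩ | ⟨h, h'⟩
    · exact Or.inl h.symm
    · exact Or.inr (Or.inr ⟨h, h'.symm⟩)
    · exact Or.inr (Or.inl ⟨h, h'.symm⟩)⟩
  loopless := ⟨fun a h => h.1 rfl⟩

theorem contractEdge_adj_of_ne {V : Type} (G : SimpleGraph V) {u v a b : V} (ha : a ≠ u)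
    (hb : b ≠ u) (hav : a ≠ v) (hbv : b ≠ v) : (contractEdge G u v).Adj a b ↔ G.Adj a b := by
  simp only [contractEdge]
  constructor
  · tauto
  · intro h
    exact ⟨h.ne, hav, hbv, Or.inl h⟩

theorem contractEdge_adj_left {V : Type} (G : SimpleGraph V) {u v b : V} (huv : u ≠ v)
    (hb : b ≠ u) (hbv : b ≠ v) :
    (contractEdge G u v).Adj u b ↔ G.Adj u b ∨ G.Adj v b := by
  simp only [contractEdge]
  have := hb.symm
  tauto

theorem not_contractEdge_adj_right {V : Type} (G : SimpleGraph V) (u v b : V) :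
    ¬ (contractEdge G u v).Adj v b := by
  simp [contractEdge]

theorem IsAttachedHole.contractEdge_comm {V : Type} [DecidableEq V] {G : SimpleGraph V} {u v : V}
    {C K : Set V} {p q a b : V} (h : IsAttachedHole (contractEdge G u v) C K p q a b) :
    IsAttachedHole (contractEdge G v u) (Equiv.swap u v '' C) (Equiv.swap u v '' K)
      (Equiv.swap u v p) (Equiv.swap u v q) (Equiv.swap u v a) (Equiv.swap u v b) := by
  refine h.image _ (Equiv.injective _) fun x _ y _ => ?_
  have key : ∀ u v x y, (contractEdge G u v).Adj x y →
      (contractEdge G v u).Adj (Equiv.swap u v x) (Equiv.swap u v y) := by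
    intro u v x y
    simp only [contractEdge, Equiv.swap_apply_def]
    have h1 : ∀ a, ¬ G.Adj a a := fun a => G.irrefl
    have h2 : ∀ a b, G.Adj a b → G.Adj b a := fun a b => SimpleGraph.Adj.symm
    grind
  exact ⟨key u v x y, fun hxy => by simpa [Equiv.swap_comm v u] using key v u _ _ hxy⟩

theorem IsAttachedHole.symm {V : Type} {G : SimpleGraph V} {C K : Set V} {p q a b : V}
    (h : IsAttachedHole G C K p q a b) : IsAttachedHole G C K q p a b :=
  { h with
    mem_p := h.mem_q
    mem_q := h.mem_p
    adj := h.adj.symm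
    not_adj_p := h.not_adj_q
    not_adj_q := h.not_adj_p }

theorem IsAttachedHole.right_notMem_hole {V : Type} {G : SimpleGraph V} {u v : V} {C K : Set V}
    {p q a b : V} (h : IsAttachedHole (contractEdge G u v) C K p q a b) : v ∉ C := by
  intro hv
  obtain ⟨y, _, _, _, _, hy, _⟩ := h.regular v hv
  exact not_contractEdge_adj_right G u v y hy

theorem IsAttachedHole.right_notMem_attached {V : Type} {G : SimpleGraph V} {u v : V}
    {C K : Set V} {p q a b : V} (h : IsAttachedHole (contractEdge G u v) C K p q a b) : v ∉ K := by
  intro hv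
  have hK : K ⊆ {v} := by
    apply h.conn_right.2 {v} ⟨v, hv, rfl⟩
    rintro _ _ rfl b _ hb
    exact absurd hb (not_contractEdge_adj_right G u _ b)
  obtain ⟨k, hk, hak⟩ := h.adj_a
  obtain rfl : k = v := hK hk
  exact not_contractEdge_adj_right G u k a hak.symm

theorem isConnSet_insert_of_contractEdge {V : Type} {G : SimpleGraph V} {u v : V} {S : Set V}
    (h : IsConnSet (contractEdge G u v) S) (huv : G.Adj u v) (hu : u ∈ S) :
    IsConnSet G (insert v S) := by
  refine ⟨⟨v, by simp⟩, ?_⟩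
  intro T hT hcl
  have huT : u ∈ T ↔ v ∈ T :=
    ⟨fun hx => hcl u (by simp [hu]) hx v (by simp) huv,
      fun hx => hcl v (by simp) hx u (by simp [hu]) huv.symm⟩
  have hST : S ⊆ T := by
    apply h.2 T
    · obtain ⟨a, rfl | ha, haT⟩ := hT
      · exact ⟨u, hu, huT.2 haT⟩
      · exact ⟨a, ha, haT⟩
    · rintro a ha haT b hb ⟨-, -, -, hab | ⟨rfl, hab⟩ | ⟨rfl, hab⟩⟩
      · exact hcl a (by simp [ha]) haT b (by simp [hb]) hab
      · exact hcl v (by simp) (huT.1 haT) b (by simp [hb]) hab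
      · exact huT.2 (hcl a (by simp [ha]) haT v (by simp) hab)
  rintro z (rfl | hz)
  · exact huT.1 (hST hu)
  · exact hST hz

theorem IsAttachedHole.of_adj_iff {V : Type} {G H : SimpleGraph V}
    {C K L : Set V} {p q p' q' a b a' b' : V} (h : IsAttachedHole H C K p q a b)
    (hC : ∀ x ∈ C, ∀ y ∈ C, (H.Adj x y ↔ G.Adj x y)) (hL : IsConnSet G L)
    (hd : ∀ x ∈ C, x ∉ L) (hp : p' ∈ C) (hq : q' ∈ C) (hpq : H.Adj p' q')
    (hpL : ∀ k ∈ L, ¬ G.Adj p' k) (hqL : ∀ k ∈ L, ¬ G.Adj q' k) (ha : a' ∈ C) (hb : b' ∈ C)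
    (hab : a' ≠ b') (haL : ∃ k ∈ L, G.Adj a' k) (hbL : ∃ k ∈ L, G.Adj b' k) :
    IsAttachedHole G C L p' q' a' b' where
  conn := h.conn.congr fun x hx y hy => (hC x hx y hy).1
  regular := by
    intro x hx
    obtain ⟨y, hy, z, hz, hyz, hxy, hxz, ht⟩ := h.regular x hx
    exact ⟨y, hy, z, hz, hyz, (hC x hx y hy).1 hxy, (hC x hx z hz).1 hxz,
      fun t htC hxt => ht t htC ((hC x hx t htC).2 hxt)⟩
  conn_right := hL
  disjoint := hd
  mem_p := hp
  mem_q := hq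
  adj := (hC _ hp _ hq).1 hpq
  not_adj_p := hpL
  not_adj_q := hqL
  mem_a := ha
  mem_b := hb
  ne := hab
  adj_a := haL
  adj_b := hbL

theorem HasAttachedHole.of_contractEdge_of_notMem {V : Type} {G : SimpleGraph V} {u v : V}
    {C K : Set V} {p q a b : V} (huv : G.Adj u v)
    (h : IsAttachedHole (contractEdge G u v) C K p q a b) (hu : u ∉ C) : HasAttachedHole G := by
  have hvC := h.right_notMem_hole
  have hvK := h.right_notMem_attached
  have hC : ∀ x ∈ C, ∀ y ∈ C, ((contractEdge G u v).Adj x y ↔ G.Adj x y) := fun x hx y hy =>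
    contractEdge_adj_of_ne G (by grind) (by grind) (by grind) (by grind)
  have hCne : ∀ x ∈ C, x ≠ u ∧ x ≠ v := by grind
  have hKne : ∀ x ∈ K, x ≠ v := by grind
  have hd := h.disjoint
  by_cases huK : u ∈ K
  · have hadj : ∀ x ∈ C, (∃ k ∈ K, (contractEdge G u v).Adj x k) ↔
        ∃ k ∈ insert v K, G.Adj x k := by
      intro x hx
      obtain ⟨h1, h2⟩ := hCne x hx
      simp only [contractEdge, Set.mem_insert_iff]
      constructor
      · rintro ⟨k, hk, -, -, -, hG | ⟨rfl, hG⟩ | ⟨rfl, hG⟩⟩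
        · exact ⟨k, Or.inr hk, hG⟩
        · exact absurd rfl h1
        · exact ⟨v, Or.inl rfl, hG⟩
      · rintro ⟨k, rfl | hk, hG⟩
        · exact ⟨u, huK, h1, h2, huv.ne, Or.inr (Or.inr ⟨rfl, hG⟩)⟩
        · exact ⟨k, hk, hG.ne, h2, hKne k hk, Or.inl hG⟩
    refine ⟨C, insert v K, p, q, a, b, h.of_adj_iff hC (isConnSet_insert_of_contractEdge h.conn_right huv huK)
      (fun x hx => ?_) h.mem_p h.mem_q h.adj (fun k hk hpk => ?_) (fun k hk hpk => ?_) h.mem_a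
      h.mem_b h.ne ((hadj a h.mem_a).1 h.adj_a) ((hadj b h.mem_b).1 h.adj_b)⟩
    · rintro (rfl | hxK)
      · exact hvC hx
      · exact hd x hx hxK
    · obtain ⟨l, hl, h1⟩ := (hadj p h.mem_p).2 ⟨k, hk, hpk⟩
      exact h.not_adj_p l hl h1
    · obtain ⟨l, hl, h1⟩ := (hadj q h.mem_q).2 ⟨k, hk, hpk⟩
      exact h.not_adj_q l hl h1
  · have hK : ∀ x ∈ C ∪ K, ∀ y ∈ C ∪ K, ((contractEdge G u v).Adj x y ↔ G.Adj x y) :=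
      fun x hx y hy => contractEdge_adj_of_ne G (by grind) (by grind) (by grind) (by grind)
    simpa using ⟨_, _, _, _, _, _, h.image id Function.injective_id hK⟩

theorem contractEdge_adj_iff_of_adj_imp {V : Type} {G : SimpleGraph V} {u v : V} {C : Set V}
    (huv : G.Adj u v) (hvC : v ∉ C) (hcov : ∀ t ∈ C, (contractEdge G u v).Adj u t → G.Adj u t) :
    ∀ x ∈ C, ∀ y ∈ C, ((contractEdge G u v).Adj x y ↔ G.Adj x y) := by
  intro x hx y hy
  have hxv : x ≠ v := fun e => hvC (e ▸ hx)
  have hyv : y ≠ v := fun e => hvC (e ▸ hy)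
  constructor
  · intro h
    by_cases hxu : x = u
    · subst hxu
      exact hcov y hy h
    · by_cases hyu : y = u
      · subst hyu
        exact (hcov x hx h.symm).symm
      · exact (contractEdge_adj_of_ne G hxu hyu hxv hyv).1 h
  · exact fun h => ⟨h.ne, hxv, hyv, Or.inl h⟩

theorem HasAttachedHole.of_contractEdge_of_adj_imp {V : Type} {G : SimpleGraph V} {u v : V}
    {C K : Set V} {p q a b : V} (huv : G.Adj u v)
    (h : IsAttachedHole (contractEdge G u v) C K p q a b) (hu : u ∈ C)
    (hcov : ∀ t ∈ C, (contractEdge G u v).Adj u t → G.Adj u t)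
    (htouch : (∃ k ∈ K, (contractEdge G u v).Adj u k) → ∃ k ∈ K, G.Adj u k) :
    HasAttachedHole G := by
  have hvC := h.right_notMem_hole
  have hvK := h.right_notMem_attached
  have huK := h.disjoint u hu
  have hK : ∀ x ∈ K, ∀ y ∈ K, ((contractEdge G u v).Adj x y ↔ G.Adj x y) := fun x hx y hy =>
    contractEdge_adj_of_ne G (by grind) (by grind) (by grind) (by grind)
  have hG : ∀ x ∈ C, ∀ k ∈ K, G.Adj x k → (contractEdge G u v).Adj x k := fun x hx k hk hxk =>
    ⟨hxk.ne, by grind, by grind, Or.inl hxk⟩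
  have htouch' : ∀ x ∈ C, (∃ k ∈ K, (contractEdge G u v).Adj x k) → ∃ k ∈ K, G.Adj x k := by
    rintro x hx ⟨k, hk, hxk⟩
    by_cases hxu : x = u
    · subst hxu
      exact htouch ⟨k, hk, hxk⟩
    · exact ⟨k, hk, (contractEdge_adj_of_ne G hxu (by grind) (by grind) (by grind)).1 hxk⟩
  exact ⟨C, K, p, q, a, b, h.of_adj_iff (contractEdge_adj_iff_of_adj_imp huv hvC hcov)
    (h.conn_right.congr fun x hx y hy => (hK x hx y hy).1) h.disjoint h.mem_p h.mem_q h.adj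
    (fun k hk hpk => h.not_adj_p k hk (hG p h.mem_p k hk hpk))
    (fun k hk hqk => h.not_adj_q k hk (hG q h.mem_q k hk hqk)) h.mem_a h.mem_b h.ne
    (htouch' a h.mem_a h.adj_a) (htouch' b h.mem_b h.adj_b)⟩

theorem HasAttachedHole.of_contractEdge_of_adj_left {V : Type} {G : SimpleGraph V} {u v : V}
    {C K : Set V} {p q a b : V} (huv : G.Adj u v)
    (h : IsAttachedHole (contractEdge G u v) C K p q a b) (hu : u ∈ C)
    (hcov : ∀ t ∈ C, (contractEdge G u v).Adj u t → G.Adj u t)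
    (hcov' : ∃ t ∈ C, (contractEdge G u v).Adj u t ∧ ¬ G.Adj v t)
    (htouch : ∃ k ∈ K, (contractEdge G u v).Adj u k) (hvp : G.Adj v p) :
    HasAttachedHole G := by
  have hvC := h.right_notMem_hole
  have hvK := h.right_notMem_attached
  have hpu : p ≠ u := by
    rintro rfl
    obtain ⟨k, hk, hk'⟩ := htouch
    exact h.not_adj_p k hk hk'
  have hqu : q ≠ u := by
    rintro rfl
    obtain ⟨k, hk, hk'⟩ := htouch
    exact h.not_adj_q k hk hk'
  have hD : ∀ t ∈ C, t ≠ u → G.Adj v t → (contractEdge G u v).Adj u t := fun t ht htu hvt =>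
    (contractEdge_adj_left G huv.ne htu hvt.ne').2 (Or.inr hvt)
  obtain ⟨z, hz, huz, hvz⟩ := hcov'
  have hup := hD p h.mem_p hpu hvp
  have hpz : p ≠ z := by
    rintro rfl
    exact hvz hvp
  have hnbr : ∀ t ∈ C, (contractEdge G u v).Adj u t → t = p ∨ t = z := by
    obtain ⟨y1, -, z1, -, -, -, -, h1⟩ := h.regular u hu
    intro t ht hut
    have := h1 t ht hut
    have := h1 p h.mem_p hup
    have := h1 z hz huz
    grind
  obtain ⟨z', hz', huz', hzz', hnbrz⟩ : ∃ z' ∈ C, z' ≠ u ∧ (contractEdge G u v).Adj z z' ∧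
      ∀ t ∈ C, (contractEdge G u v).Adj z t → t = u ∨ t = z' := by
    obtain ⟨y1, hy1, z1, hz1, hne, hzy, hzz, h1⟩ := h.regular z hz
    rcases h1 u hu huz.symm with rfl | rfl
    · exact ⟨z1, hz1, hne.symm, hzz, h1⟩
    · exact ⟨y1, hy1, hne, hzy, fun t ht h' => (h1 t ht h').symm⟩
  have hvz' : ¬ G.Adj v z' := by
    intro hadj
    rcases hnbr z' hz' (hD z' hz' huz' hadj) with rfl | rfl
    · have hnbrp : ∀ t ∈ C, (contractEdge G u v).Adj z' t → t = u ∨ t = z := by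
        obtain ⟨y1, -, z1, -, -, -, -, h1⟩ := h.regular z' hz'
        intro t ht hut
        have := h1 t ht hut
        have := h1 u hu hup.symm
        have := h1 z hz hzz'.symm
        have := huz.ne
        grind
      have hsub : C ⊆ {u, z', z} := by
        apply h.conn.2 {u, z', z} ⟨u, hu, by simp⟩
        simp only [Set.mem_insert_iff, Set.mem_singleton_iff]
        rintro x hx (rfl | rfl | rfl) t ht hxt
        · exact Or.inr (hnbr t ht hxt)
        · have := hnbrp t ht hxt
          tauto
        · have := hnbrz t ht hxt
          tauto
      have hq : q = z := by
        have hq := hsub h.mem_q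
        have := h.adj.ne
        simp only [Set.mem_insert_iff, Set.mem_singleton_iff] at hq
        grind
      have hu_of : ∀ x ∈ C, (∃ k ∈ K, (contractEdge G u v).Adj x k) → x = u := by
        rintro x hx ⟨k, hk, hxk⟩
        rcases hsub hx with rfl | rfl | rfl
        · rfl
        · exact absurd hxk (h.not_adj_p k hk)
        · exact absurd (hq ▸ hxk) (h.not_adj_q k hk)
      exact h.ne ((hu_of a h.mem_a h.adj_a).trans (hu_of b h.mem_b h.adj_b).symm)
    · exact hzz'.ne rfl
  refine ⟨C, {v}, z, z', u, p, h.of_adj_iff (contractEdge_adj_iff_of_adj_imp huv hvC hcov)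
    (IsConnSet.singleton G v) (fun x hx hxv => hvC (hxv ▸ hx)) hz hz' hzz' ?_ ?_ hu h.mem_p hpu.symm
    ⟨v, rfl, huv⟩ ⟨v, rfl, hvp.symm⟩⟩
  · rintro _ rfl hzv
    exact hvz hzv.symm
  · rintro _ rfl hzv
    exact hvz' hzv.symm

theorem HasAttachedHole.of_contractEdge_of_not_adj {V : Type} {G : SimpleGraph V} {u v : V}
    {C K : Set V} {p q a b : V} (huv : G.Adj u v)
    (h : IsAttachedHole (contractEdge G u v) C K p q a b) (hu : u ∈ C)
    (hcov : ∀ t ∈ C, (contractEdge G u v).Adj u t → G.Adj u t)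
    (hcov' : ∃ t ∈ C, (contractEdge G u v).Adj u t ∧ ¬ G.Adj v t)
    (htouch : ∃ k ∈ K, (contractEdge G u v).Adj u k) (htouch' : ∀ k ∈ K, ¬ G.Adj u k) :
    HasAttachedHole G := by
  by_cases hvp : G.Adj v p
  · exact of_contractEdge_of_adj_left huv h hu hcov hcov' htouch hvp
  by_cases hvq : G.Adj v q
  · exact of_contractEdge_of_adj_left huv h.symm hu hcov hcov' htouch hvq
  have hvC := h.right_notMem_hole
  have hvK := h.right_notMem_attached
  have huK := h.disjoint u hu
  have hK : ∀ x ∈ K, ∀ y ∈ K, ((contractEdge G u v).Adj x y ↔ G.Adj x y) := fun x hx y hy =>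
    contractEdge_adj_of_ne G (by grind) (by grind) (by grind) (by grind)
  have hG : ∀ x ∈ C, ∀ k ∈ K, G.Adj x k → (contractEdge G u v).Adj x k := fun x hx k hk hxk =>
    ⟨hxk.ne, by grind, by grind, Or.inl hxk⟩
  obtain ⟨k₀, hk₀, huk⟩ := htouch
  have hvk : G.Adj v k₀ :=
    ((contractEdge_adj_left G huv.ne (by grind) (by grind)).1 huk).resolve_left (htouch' k₀ hk₀)
  have htouch : ∀ x ∈ C, (∃ k ∈ K, (contractEdge G u v).Adj x k) →
      ∃ k ∈ insert v K, G.Adj x k := by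
    rintro x hx ⟨k, hk, hxk⟩
    by_cases hxu : x = u
    · subst hxu
      exact ⟨v, Or.inl rfl, huv⟩
    · exact ⟨k, Or.inr hk,
        (contractEdge_adj_of_ne G hxu (by grind) (by grind) (by grind)).1 hxk⟩
  refine ⟨C, insert v K, p, q, a, b, h.of_adj_iff (contractEdge_adj_iff_of_adj_imp huv hvC hcov)
    ((h.conn_right.congr fun x hx y hy => (hK x hx y hy).1).insert hk₀ hvk) ?_ h.mem_p h.mem_q
    h.adj ?_ ?_ h.mem_a h.mem_b h.ne (htouch a h.mem_a h.adj_a) (htouch b h.mem_b h.adj_b)⟩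
  · rintro x hx (rfl | hxK)
    · exact hvC hx
    · exact h.disjoint x hx hxK
  · rintro k (rfl | hk) hpk
    · exact hvp hpk.symm
    · exact h.not_adj_p k hk (hG p h.mem_p k hk hpk)
  · rintro k (rfl | hk) hpk
    · exact hvq hpk.symm
    · exact h.not_adj_q k hk (hG q h.mem_q k hk hpk)

theorem HasAttachedHole.of_contractEdge_of_split {V : Type} {G : SimpleGraph V} {u v : V}
    {C K : Set V} {p q a b : V} (huv : G.Adj u v)
    (h : IsAttachedHole (contractEdge G u v) C K p q a b) (hu : u ∈ C)
    (hcov : ∃ t ∈ C, (contractEdge G u v).Adj u t ∧ ¬ G.Adj u t)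
    (hcov' : ∃ t ∈ C, (contractEdge G u v).Adj u t ∧ ¬ G.Adj v t) :
    HasAttachedHole G := by
  have hvC := h.right_notMem_hole
  have hvK := h.right_notMem_attached
  have huK := h.disjoint u hu
  obtain ⟨z, hz, huz, hGuz⟩ := hcov
  obtain ⟨y, hy, huy, hGvy⟩ := hcov'
  have hvz : G.Adj v z :=
    ((contractEdge_adj_left G huv.ne huz.ne' (by grind)).1 huz).resolve_left hGuz
  have hGuy : G.Adj u y :=
    ((contractEdge_adj_left G huv.ne huy.ne' (by grind)).1 huy).resolve_right hGvy
  have hyz : y ≠ z := by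
    rintro rfl
    exact hGvy hvz
  have hnbr : ∀ t ∈ C, (contractEdge G u v).Adj u t → t = y ∨ t = z := by
    obtain ⟨y1, -, z1, -, -, -, -, h1⟩ := h.regular u hu
    intro t ht hut
    have := h1 t ht hut
    have := h1 y hy huy
    have := h1 z hz huz
    grind
  have hu_adj : ∀ t ∈ C, G.Adj u t → t = y := by
    intro t ht hut
    have := hnbr t ht ((contractEdge_adj_left G huv.ne hut.ne' (by grind)).2 (Or.inl hut))
    grind
  have hv_adj : ∀ t ∈ C, t ≠ u → G.Adj v t → t = z := by
    intro t ht htu hvt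
    have := hnbr t ht ((contractEdge_adj_left G huv.ne htu hvt.ne').2 (Or.inr hvt))
    grind
  have hC : ∀ x ∈ C, x ≠ u → ∀ y ∈ C, y ≠ u → ((contractEdge G u v).Adj x y ↔ G.Adj x y) :=
    fun x hx hxu y hy hyu => contractEdge_adj_of_ne G hxu hyu (by grind) (by grind)
  have hK : ∀ x ∈ K, ∀ y ∈ K, ((contractEdge G u v).Adj x y ↔ G.Adj x y) := fun x hx y hy =>
    contractEdge_adj_of_ne G (by grind) (by grind) (by grind) (by grind)
  have hpq : ∃ p' ∈ insert v C, ∃ q' ∈ insert v C, (p' = p ∨ p = u ∧ p' = v) ∧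
      (q' = q ∨ q = u ∧ q' = v) ∧ G.Adj p' q' := by
    have hp := h.mem_p
    have hq := h.mem_q
    by_cases hpu : p = u
    · subst hpu
      rcases hnbr q hq h.adj with rfl | rfl
      · exact ⟨p, Or.inr hp, q, Or.inr hq, Or.inl rfl, Or.inl rfl, hGuy⟩
      · exact ⟨v, Or.inl rfl, q, Or.inr hq, Or.inr ⟨rfl, rfl⟩, Or.inl rfl, hvz⟩
    by_cases hqu : q = u
    · subst hqu
      rcases hnbr p hp h.adj.symm with rfl | rfl
      · exact ⟨p, Or.inr hp, q, Or.inr hq, Or.inl rfl, Or.inl rfl, hGuy.symm⟩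
      · exact ⟨p, Or.inr hp, v, Or.inl rfl, Or.inl rfl, Or.inr ⟨rfl, rfl⟩, hvz.symm⟩
    · exact ⟨p, Or.inr hp, q, Or.inr hq, Or.inl rfl, Or.inl rfl, (hC p hp hpu q hq hqu).1 h.adj⟩
  have hfree : ∀ x ∈ C, (∀ k ∈ K, ¬ (contractEdge G u v).Adj x k) →
      ∀ x', (x' = x ∨ x = u ∧ x' = v) → ∀ k ∈ K, ¬ G.Adj x' k := by
    rintro x hx hxK x' (rfl | ⟨rfl, rfl⟩) k hk hadj
    · exact hxK k hk ⟨hadj.ne, by grind, by grind, Or.inl hadj⟩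
    · exact hxK k hk ((contractEdge_adj_left G huv.ne (by grind) (by grind)).2 (Or.inr hadj))
  have htouch : ∀ x ∈ C, (∃ k ∈ K, (contractEdge G u v).Adj x k) →
      ∃ x' ∈ insert v C, (x' = x ∨ x = u ∧ x' = v) ∧ ∃ k ∈ K, G.Adj x' k := by
    rintro x hx ⟨k, hk, hxk⟩
    by_cases hxu : x = u
    · subst hxu
      rcases (contractEdge_adj_left G huv.ne (by grind) (by grind)).1 hxk with hxk | hxk
      · exact ⟨x, Or.inr hx, Or.inl rfl, k, hk, hxk⟩
      · exact ⟨v, Or.inl rfl, Or.inr ⟨rfl, rfl⟩, k, hk, hxk⟩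
    · exact ⟨x, Or.inr hx, Or.inl rfl, k, hk,
        (contractEdge_adj_of_ne G hxu (by grind) (by grind) (by grind)).1 hxk⟩
  obtain ⟨p', hp', q', hq', hpp, hqq, hpq'⟩ := hpq
  obtain ⟨a', ha', haa, haK⟩ := htouch a h.mem_a h.adj_a
  obtain ⟨b', hb', hbb, hbK⟩ := htouch b h.mem_b h.adj_b
  have hmem_a := h.mem_a
  have hmem_b := h.mem_b
  have hne := h.ne
  refine ⟨insert v C, K, p', q', a', b', isConnSet_insert_of_contractEdge h.conn huv hu, ?_,
    h.conn_right.congr fun x hx y hy => (hK x hx y hy).1, ?_, hp', hq', hpq',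
    hfree p h.mem_p h.not_adj_p p' hpp, hfree q h.mem_q h.not_adj_q q' hqq, ha', hb', by grind,
    haK, hbK⟩
  · rintro x (rfl | hx)
    · refine ⟨u, Or.inr hu, z, Or.inr hz, huz.ne, huv.symm, hvz, ?_⟩
      rintro t (rfl | ht) hxt
      · exact absurd rfl hxt.ne
      · have := hv_adj t ht
        tauto
    by_cases hxu : x = u
    · subst hxu
      refine ⟨v, Or.inl rfl, y, Or.inr hy, by grind, huv, hGuy, ?_⟩
      rintro t (rfl | ht) hxt
      · exact Or.inl rfl
      · exact Or.inr (hu_adj t ht hxt)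
    obtain ⟨y1, hy1, z1, hz1, hne1, hxy1, hxz1, h1⟩ := h.regular x hx
    by_cases hxz : x = z
    · subst hxz
      obtain ⟨w, hw, hwu, hxw, hw'⟩ : ∃ w ∈ C, w ≠ u ∧ (contractEdge G u v).Adj x w ∧
          ∀ t ∈ C, (contractEdge G u v).Adj x t → t = u ∨ t = w := by
        rcases h1 u hu huz.symm with rfl | rfl
        · exact ⟨z1, hz1, hne1.symm, hxz1, h1⟩
        · exact ⟨y1, hy1, hne1, hxy1, fun t ht h' => (h1 t ht h').symm⟩
      refine ⟨v, Or.inl rfl, w, Or.inr hw, by grind, hvz.symm, (hC x hx hxu w hw hwu).1 hxw, ?_⟩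
      rintro t (rfl | ht) hxt
      · exact Or.inl rfl
      · have htu : t ≠ u := by
          rintro rfl
          exact hGuz hxt.symm
        exact Or.inr ((hw' t ht ((hC x hx hxu t ht htu).2 hxt)).resolve_left htu)
    have hiff : ∀ t ∈ C, (contractEdge G u v).Adj x t ↔ G.Adj x t := by
      intro t ht
      by_cases htu : t = u
      · subst htu
        constructor
        · intro hxt
          obtain rfl := (hnbr x hx hxt.symm).resolve_right hxz
          exact hGuy.symm
        · exact fun hxt => ⟨hxt.ne, by grind, huv.ne, Or.inl hxt⟩
      · exact hC x hx hxu t ht htu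
    refine ⟨y1, Or.inr hy1, z1, Or.inr hz1, hne1, (hiff _ hy1).1 hxy1, (hiff _ hz1).1 hxz1, ?_⟩
    rintro t (rfl | ht) hxt
    · exact absurd (hv_adj x hx hxu hxt.symm) hxz
    · exact h1 t ht ((hiff t ht).2 hxt)
  · rintro x (rfl | hx)
    · exact hvK
    · exact h.disjoint x hx

theorem mem_swap_image_iff {V : Type} [DecidableEq V] {G : SimpleGraph V} {u v : V} {S : Set V}
    (huv : u ≠ v) (t : V) : t ∈ Equiv.swap u v '' S ∧ (contractEdge G v u).Adj v t ↔
      t ∈ S ∧ (contractEdge G u v).Adj u t := by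
  by_cases htu : t = u
  · subst htu
    simp [contractEdge]
  by_cases htv : t = v
  · subst htv
    simp [contractEdge]
  rw [contractEdge_adj_left G huv htu htv, contractEdge_adj_left G huv.symm htv htu,
    Equiv.image_eq_preimage_symm, Set.mem_preimage, Equiv.symm_swap,
    Equiv.swap_apply_of_ne_of_ne htu htv, or_comm]

theorem HasAttachedHole.of_contractEdge_of_adj {V : Type} {G : SimpleGraph V} {u v : V}
    {C K : Set V} {p q a b : V} (huv : G.Adj u v)
    (h : IsAttachedHole (contractEdge G u v) C K p q a b) (hu : u ∈ C)
    (hcov : ∀ t ∈ C, (contractEdge G u v).Adj u t → G.Adj u t) : HasAttachedHole G := by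
  classical
  by_cases htouch : (∃ k ∈ K, (contractEdge G u v).Adj u k) → ∃ k ∈ K, G.Adj u k
  · exact of_contractEdge_of_adj_imp huv h hu hcov htouch
  push Not at htouch
  by_cases hcov' : ∃ t ∈ C, (contractEdge G u v).Adj u t ∧ ¬ G.Adj v t
  · exact of_contractEdge_of_not_adj huv h hu hcov hcov' htouch.1 htouch.2
  push Not at hcov'
  refine of_contractEdge_of_adj_imp huv.symm h.contractEdge_comm ⟨u, hu, by simp⟩ ?_ ?_
  · intro t ht hvt
    have ht' := (mem_swap_image_iff huv.ne t).1 ⟨ht, hvt⟩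
    exact hcov' t ht'.1 ht'.2
  · rintro ⟨k, hk, hvk⟩
    have hk' := (mem_swap_image_iff huv.ne k).1 ⟨hk, hvk⟩
    refine ⟨k, hk, ?_⟩
    have hkv : k ≠ v := hvk.ne'
    exact ((contractEdge_adj_left G huv.ne hk'.2.ne' hkv).1 hk'.2).resolve_left (htouch.2 k hk'.1)

theorem HasAttachedHole.of_contractEdge {V : Type} {G : SimpleGraph V} {u v : V}
    (huv : G.Adj u v) (h : HasAttachedHole (contractEdge G u v)) : HasAttachedHole G := by
  classical
  obtain ⟨C, K, p, q, a, b, h⟩ := h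
  by_cases hu : u ∈ C
  swap
  · exact of_contractEdge_of_notMem huv h hu
  by_cases hcov : ∀ t ∈ C, (contractEdge G u v).Adj u t → G.Adj u t
  · exact of_contractEdge_of_adj huv h hu hcov
  by_cases hcov' : ∀ t ∈ C, (contractEdge G u v).Adj u t → G.Adj v t
  · refine of_contractEdge_of_adj huv.symm h.contractEdge_comm ⟨u, hu, by simp⟩ ?_
    intro t ht hvt
    have ht' := (mem_swap_image_iff huv.ne t).1 ⟨ht, hvt⟩
    exact hcov' t ht'.1 ht'.2
  push Not at hcov hcov'
  exact of_contractEdge_of_split huv h hu hcov hcov'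

theorem isConnSet_contractEdge {V : Type} {G : SimpleGraph V} {u v : V} {S : Set V}
    (huv : G.Adj u v) (h : IsConnSet G S) (hu : u ∈ S) :
    IsConnSet (contractEdge G u v) (S \ {v}) := by
  refine ⟨⟨u, hu, huv.ne⟩, ?_⟩
  rintro T ⟨a, ⟨ha, hav⟩, haT⟩ hcl b ⟨hb, hbv⟩
  have hcl' : ∀ a ∈ S, a ≠ v → a ∈ T → ∀ b ∈ S, b ≠ v → (contractEdge G u v).Adj a b → b ∈ T :=
    fun a ha hav haT b hb hbv => hcl a ⟨ha, hav⟩ haT b ⟨hb, hbv⟩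
  have huT : ∀ x ∈ S, x ≠ v → G.Adj x v → (x ∈ T ↔ u ∈ T) := by
    intro x hx hxv hadj
    by_cases hxu : x = u
    · rw [hxu]
    have hD := (contractEdge_adj_left G huv.ne hxu hxv).2 (Or.inr hadj.symm)
    exact ⟨fun h => hcl' x hx hxv h u hu huv.ne hD.symm, fun h => hcl' u hu huv.ne h x hx hxv hD⟩
  have key := h.2 {x | x ≠ v ∧ x ∈ T ∨ x = v ∧ u ∈ T} ⟨a, ha, Or.inl ⟨hav, haT⟩⟩ ?_ hb
  · exact (key.resolve_right fun h => hbv h.1).2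
  rintro x hx (⟨hxv, hxT⟩ | ⟨rfl, hxT⟩) y hy hxy
  · by_cases hyv : y = v
    · subst hyv
      exact Or.inr ⟨rfl, (huT x hx hxv hxy).1 hxT⟩
    · exact Or.inl ⟨hyv, hcl' x hx hxv hxT y hy hyv ⟨hxy.ne, hxv, hyv, Or.inl hxy⟩⟩
  · have hyx : y ≠ x := hxy.ne'
    exact Or.inl ⟨hyx, (huT y hy hyx hxy.symm).2 hxT⟩

theorem hasAttachedHole_of_inducedMinor {V : Type} [Finite V] {G : SimpleGraph V}
    (h : InducedMinor house G) : HasAttachedHole G := by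
  classical
  obtain ⟨X, hX⟩ := h
  induction hn : (⋃ w, X w).ncard using Nat.strong_induction_on generalizing G X with
  | _ n ih =>
  obtain ⟨hne, hconn, hdisj, hadj, hnadj⟩ := hX
  by_cases hsub : ∀ w, (X w).Subsingleton
  · choose x hx using hne
    have hx' : ∀ w a, a ∈ X w → a = x w := fun w a ha => hsub w ha (hx w)
    have hiff : ∀ u w, G.Adj (x u) (x w) ↔ house.Adj u w := by
      intro u w
      constructor
      · intro h
        by_contra hc
        exact hnadj u w (by rintro rfl; exact h.ne rfl) hc _ (hx u) _ (hx w) h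
      · intro h
        obtain ⟨a, ha, b, hb, hab⟩ := hadj u w h
        rwa [hx' u a ha, hx' w b hb] at hab
    have hinj : ∀ u w, x u = x w → u = w := by
      intro u w he
      by_contra hc
      exact Set.disjoint_left.1 (hdisj hc) (hx u) (he ▸ hx w)
    have h01 : G.Adj (x 0) (x 1) := by rw [hiff, house_adj_iff]; decide
    have h12 : G.Adj (x 1) (x 2) := by rw [hiff, house_adj_iff]; decide
    have h23 : G.Adj (x 2) (x 3) := by rw [hiff, house_adj_iff]; decide
    have h03 : G.Adj (x 0) (x 3) := by rw [hiff, house_adj_iff]; decide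
    have h04 : G.Adj (x 0) (x 4) := by rw [hiff, house_adj_iff]; decide
    have h34 : G.Adj (x 3) (x 4) := by rw [hiff, house_adj_iff]; decide
    have h02 : ¬ G.Adj (x 0) (x 2) := by rw [hiff, house_adj_iff]; decide
    have h13 : ¬ G.Adj (x 1) (x 3) := by rw [hiff, house_adj_iff]; decide
    have h14 : ¬ G.Adj (x 1) (x 4) := by rw [hiff, house_adj_iff]; decide
    have h24 : ¬ G.Adj (x 2) (x 4) := by rw [hiff, house_adj_iff]; decide
    have hd : ∀ u w, u ≠ w → x u ≠ x w := fun u w h e => h (hinj u w e)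
    refine ⟨{x 0, x 1, x 2, x 3}, {x 4}, x 1, x 2, x 0, x 3, ?_, ?_, IsConnSet.singleton G _, ?_,
      by simp, by simp, h12, by simpa using h14, by simpa using h24, by simp, by simp,
      h03.ne, by simpa using h04, by simpa using h34⟩
    · exact (((IsConnSet.singleton G _).insert rfl h23).insert (y := x 2) (by simp) h12).insert
        (y := x 1) (by simp) h01
    · simp only [Set.mem_insert_iff, Set.mem_singleton_iff]
      rintro _ (rfl | rfl | rfl | rfl)
      · refine ⟨x 1, by simp, x 3, by simp, hd _ _ (by decide), h01, h03, ?_⟩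
        rintro _ (rfl | rfl | rfl | rfl) h <;> simp_all
      · refine ⟨x 0, by simp, x 2, by simp, hd _ _ (by decide), h01.symm, h12, ?_⟩
        rintro _ (rfl | rfl | rfl | rfl) h <;> simp_all
      · refine ⟨x 1, by simp, x 3, by simp, hd _ _ (by decide), h12.symm, h23, ?_⟩
        rintro _ (rfl | rfl | rfl | rfl) h
        · exact absurd h.symm h02
        · simp
        · exact absurd rfl h.ne
        · simp
      · refine ⟨x 0, by simp, x 2, by simp, hd _ _ (by decide), h03.symm, h23.symm, ?_⟩
        rintro _ (rfl | rfl | rfl | rfl) h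
        · simp
        · exact absurd h.symm h13
        · simp
        · exact absurd rfl h.ne
    · rintro _ (rfl | rfl | rfl | rfl) h
      · exact hd _ _ (by decide) h
      · exact hd _ _ (by decide) h
      · exact hd _ _ (by decide) h
      · exact hd _ _ (by decide) h
  obtain ⟨w, hw⟩ := not_forall.1 hsub
  obtain ⟨u, hu, v, hv, huv⟩ : ∃ u ∈ X w, ∃ v ∈ X w, G.Adj u v := by
    obtain ⟨a, ha, b, hb, hab⟩ := Set.not_subsingleton_iff.1 hw
    by_contra hc
    push Not at hc
    have := ((isConnSet_iff_connected G _).2 (hconn w)).2 {a} ⟨a, ha, rfl⟩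
      (fun a ha _ b hb h => absurd h (hc a ha b hb)) hb
    exact hab this.symm
  have hvw : ∀ z, v ∈ X z → z = w := by
    intro z hz
    by_contra hc
    exact Set.disjoint_left.1 (hdisj hc) hz hv
  have huw : ∀ z, u ∈ X z → z = w := by
    intro z hz
    by_contra hc
    exact Set.disjoint_left.1 (hdisj hc) hz hu
  refine HasAttachedHole.of_contractEdge huv
    (ih _ ?_ (fun z => X z \ {v}) ⟨fun z => ?_, fun z => ?_, fun y z hyz => ?_, ?_, ?_⟩ rfl)
  · rw [← hn]
    refine Set.ncard_lt_ncard ⟨Set.iUnion_mono fun z => Set.sdiff_subset, fun hsub => ?_⟩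
      (Set.toFinite _)
    obtain ⟨z, hz⟩ := Set.mem_iUnion.1 (hsub (Set.mem_iUnion.2 ⟨w, hv⟩))
    exact hz.2 rfl
  · by_cases hz : z = w
    · exact ⟨u, hz ▸ hu, huv.ne⟩
    · obtain ⟨a, ha⟩ := hne z
      exact ⟨a, ha, fun h => hz (hvw z (h ▸ ha))⟩
  · rw [← isConnSet_iff_connected]
    have hz := (isConnSet_iff_connected G _).2 (hconn z)
    by_cases hzw : z = w
    · subst hzw
      exact isConnSet_contractEdge huv hz hu
    · have hvz : v ∉ X z := fun h => hzw (hvw z h)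
      have huz : u ∉ X z := fun h => hzw (huw z h)
      change IsConnSet _ (X z \ {v})
      rw [Set.sdiff_singleton_eq_self hvz]
      exact hz.congr fun a ha b hb hab => ⟨hab.ne, by grind, by grind, Or.inl hab⟩
  · exact (hdisj hyz).mono Set.sdiff_subset Set.sdiff_subset
  · intro y z hyz
    obtain ⟨a, ha, b, hb, hab⟩ := hadj y z hyz
    have huw' : u ∈ X w \ {v} := ⟨hu, huv.ne⟩
    have hyz' : ∀ c ∈ X y, ∀ d ∈ X z, c ≠ d := by
      rintro c hc _ hd rfl
      exact Set.disjoint_left.1 (hdisj hyz.ne) hc hd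
    by_cases hav : a = v
    · subst hav
      obtain rfl := hvw y ha
      have hba : b ≠ a := hab.ne'
      exact ⟨u, huw', b, ⟨hb, hba⟩, hyz' u hu b hb, huv.ne, hba, Or.inr (Or.inl ⟨rfl, hab⟩)⟩
    by_cases hbv : b = v
    · subst hbv
      obtain rfl := hvw z hb
      exact ⟨a, ⟨ha, hav⟩, u, huw', hyz' a ha u hu, hav, huv.ne, Or.inr (Or.inr ⟨rfl, hab⟩)⟩
    · exact ⟨a, ⟨ha, hav⟩, b, ⟨hb, hbv⟩, hab.ne, hav, hbv, Or.inl hab⟩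
  · rintro y z hyz hH a ⟨ha, hav⟩ b ⟨hb, hbv⟩ ⟨-, -, -, hab | ⟨rfl, hab⟩ | ⟨rfl, hab⟩⟩
    · exact hnadj y z hyz hH a ha b hb hab
    · obtain rfl := huw y ha
      exact hnadj y z hyz hH v hv b hb hab
    · obtain rfl := huw z hb
      exact hnadj y z hyz hH a ha v hv hab

/-! ### Thetas and twin wheels from a cycle with an ear -/

/-- `f 0, …, f M` are the consecutive vertices of an induced cycle of `G`. -/
structure IsInducedCycle {V : Type} (G : SimpleGraph V) (M : ℕ) (f : ℕ → V) : Prop where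
  two_le : 2 ≤ M
  inj : ∀ i ≤ M, ∀ j ≤ M, f i = f j → i = j
  adj_iff : ∀ i ≤ M, ∀ j ≤ M, (G.Adj (f i) (f j) ↔
    j = i + 1 ∨ i = j + 1 ∨ (i = 0 ∧ j = M) ∨ (j = 0 ∧ i = M))

/-- `g 0, …, g l` is an induced path of `G` disjoint from `f 0, …, f M`, and the only edges between
the two are those from `g 0` to `f i` and from `g l` to `f j`. -/
structure IsInducedEar {V : Type} (G : SimpleGraph V) (M : ℕ) (f : ℕ → V) (l : ℕ) (g : ℕ → V)
    (i j : ℕ) : Prop where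
  inj : ∀ s ≤ l, ∀ t ≤ l, g s = g t → s = t
  adj_iff : ∀ s ≤ l, ∀ t ≤ l, (G.Adj (g s) (g t) ↔ t = s + 1 ∨ s = t + 1)
  disjoint : ∀ k ≤ M, ∀ t ≤ l, f k ≠ g t
  adj_cycle_iff : ∀ k ≤ M, ∀ t ≤ l, (G.Adj (f k) (g t) ↔ (k = i ∧ t = 0) ∨ (k = j ∧ t = l))

theorem IsInducedEar.reverse {V : Type} {G : SimpleGraph V} {M l i j : ℕ} {f g : ℕ → V}
    (h : IsInducedEar G M f l g i j) : IsInducedEar G M f l (fun t => g (l - t)) j i where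
  inj s hs t ht e := by
    have := h.inj _ (Nat.sub_le l s) _ (Nat.sub_le l t) e
    omega
  adj_iff s hs t ht := by
    rw [h.adj_iff _ (Nat.sub_le l s) _ (Nat.sub_le l t)]
    omega
  disjoint k hk t _ := h.disjoint k hk _ (Nat.sub_le l t)
  adj_cycle_iff k hk t ht := by
    rw [h.adj_cycle_iff k hk _ (Nat.sub_le l t)]
    omega

/-- The vertices of the theta formed by a cycle and an ear. -/
def thetaMap {V : Type} (f g : ℕ → V) (M i j p q r : ℕ) :
    Fin 2 ⊕ (Fin p ⊕ (Fin q ⊕ Fin r)) → V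
  | Sum.inl x => f (if x = 0 then i else j)
  | Sum.inr (Sum.inl t) => f (i + 1 + t)
  | Sum.inr (Sum.inr (Sum.inl t)) => g t
  | Sum.inr (Sum.inr (Sum.inr t)) => f (if t.val < i then i - 1 - t else M - (t - i))

theorem IsInducedCycle.nonempty_gammaGraph_embedding {V : Type} {G : SimpleGraph V}
    {M l i j : ℕ} {f g : ℕ → V} (hf : IsInducedCycle G M f) (hg : IsInducedEar G M f l g i j)
    (hij : i < j) (hj : j ≤ M) :
    Nonempty (gammaGraph (j - i - 1) (l + 1) (i + (M - j)) ↪g G) := by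
  have hM := hf.two_le
  have hfin : ∀ x : Fin 2, x = 0 ∨ x = 1 := by decide
  have hinj : Function.Injective (thetaMap f g M i j (j - i - 1) (l + 1) (i + (M - j))) := by
    rintro (x | ⟨x, hx⟩ | ⟨x, hx⟩ | ⟨x, hx⟩) (y | ⟨y, hy⟩ | ⟨y, hy⟩ | ⟨y, hy⟩) hxy
    all_goals try rcases hfin x with rfl | rfl
    all_goals try rcases hfin y with rfl | rfl
    all_goals
      simp only [thetaMap, if_pos, one_ne_zero, if_false] at hxy
      first
        | rfl
        | (have := hf.inj _ (by (try split_ifs) <;> omega) _ (by (try split_ifs) <;> omega) hxy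
           simp only [reduceCtorEq, Sum.inl.injEq, Sum.inr.injEq, Fin.mk.injEq]
           (try split_ifs at this) <;> omega)
        | (have := hg.inj _ (by omega) _ (by omega) hxy
           simp only [Sum.inl.injEq, Sum.inr.injEq, Fin.mk.injEq]
           exact this)
        | exact absurd hxy (hg.disjoint _ (by (try split_ifs) <;> omega) _ (by omega))
        | exact absurd hxy.symm (hg.disjoint _ (by (try split_ifs) <;> omega) _ (by omega))
  refine ⟨⟨⟨_, hinj⟩, ?_⟩⟩
  intro x y
  simp only [Function.Embedding.coeFn_mk]
  rcases x with (x | ⟨x, hx⟩ | ⟨x, hx⟩ | ⟨x, hx⟩) <;>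
    rcases y with (y | ⟨y, hy⟩ | ⟨y, hy⟩ | ⟨y, hy⟩)
  all_goals try rcases hfin x with rfl | rfl
  all_goals try rcases hfin y with rfl | rfl
  all_goals
    simp only [thetaMap, gammaGraph, fromRel_adj, if_pos, one_ne_zero, zero_ne_one, if_false, ne_eq,
      reduceCtorEq, Sum.inl.injEq, Sum.inr.injEq, Fin.mk.injEq, true_and, false_and,
      and_false, or_false, false_or, not_true_eq_false, not_false_eq_true, iff_false]
    first
      | (rw [hf.adj_iff _ (by (try split_ifs) <;> omega) _ (by (try split_ifs) <;> omega)]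
         (try split_ifs) <;> omega)
      | (rw [hg.adj_iff _ (by omega) _ (by omega)]
         omega)
      | (rw [hg.adj_cycle_iff _ (by (try split_ifs) <;> omega) _ (by omega)]
         (try split_ifs) <;> omega)
      | (rw [G.adj_comm, hg.adj_cycle_iff _ (by (try split_ifs) <;> omega) _ (by omega)]
         (try split_ifs) <;> omega)

theorem IsInducedCycle.containsInducedSubdivision {V : Type} {G : SimpleGraph V}
    {M l i j : ℕ} {f g : ℕ → V} (hf : IsInducedCycle G M f) (hg : IsInducedEar G M f l g i j)
    (hij : i < j) (hj : j ≤ M) (h2 : 2 ≤ i + (M - j)) : ContainsInducedSubdivision house G := by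
  obtain ⟨e⟩ := hf.nonempty_gammaGraph_embedding hg hij hj
  obtain ⟨B, H', hH, ⟨e'⟩⟩ := isHouseSubdivision_gammaGraph (j - i - 1) l (i + (M - j) - 2)
  rw [Nat.sub_add_cancel h2] at e'
  exact ⟨B, H', hH, ⟨e'.toEmbedding.trans e⟩⟩

theorem IsInducedCycle.nonempty_longTwinWheel_embedding {V : Type} {G : SimpleGraph V}
    {M i : ℕ} {f : ℕ → V} {v : V} (hf : IsInducedCycle G M f) (hi : i + 2 ≤ M)
    (hv : ∀ k ≤ M, f k ≠ v) (hadj : ∀ k ≤ M, (G.Adj (f k) v ↔ k = i ∨ k = i + 1 ∨ k = i + 2)) :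
    Nonempty (longTwinWheel (M + 1) ↪g G) := by
  have hM := hf.two_le
  let φ : Fin (M + 1) ⊕ Unit → V := Sum.elim
    (fun k => f (if k.val + i ≤ M then k.val + i else k.val + i - (M + 1))) fun _ => v
  have hinj : Function.Injective φ := by
    rintro (⟨x, hx⟩ | x) (⟨y, hy⟩ | y) hxy
    · have := hf.inj _ (by split_ifs <;> omega) _ (by split_ifs <;> omega) hxy
      dsimp only at this
      simp only [Sum.inl.injEq, Fin.mk.injEq]
      split_ifs at this <;> omega
    · exact absurd hxy (hv _ (by split_ifs <;> omega))
    · exact absurd hxy.symm (hv _ (by split_ifs <;> omega))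
    · rfl
  have hcross : ∀ x y, G.Adj (φ (Sum.inl x)) (φ (Sum.inr y)) ↔
      (longTwinWheel (M + 1)).Adj (Sum.inl x) (Sum.inr y) := by
    rintro ⟨x, hx⟩ y
    rw [longTwinWheel_adj_inr]
    refine (hadj _ (by split_ifs <;> omega)).trans ?_
    simp only
    split_ifs <;> omega
  refine ⟨⟨⟨φ, hinj⟩, ?_⟩⟩
  rintro (⟨x, hx⟩ | x) (⟨y, hy⟩ | y)
  · rw [longTwinWheel_adj_inl]
    refine (hf.adj_iff _ (by split_ifs <;> omega) _ (by split_ifs <;> omega)).trans ?_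
    simp only [ne_eq, Fin.mk.injEq]
    split_ifs <;> omega
  · exact hcross _ _
  · exact (G.adj_comm _ _).trans ((hcross _ _).trans ((longTwinWheel _).adj_comm _ _))
  · simp

theorem IsInducedCycle.subdivision_or_twinWheel_of_vertex {V : Type} {G : SimpleGraph V}
    {M i₀ j₀ : ℕ} {f : ℕ → V} {v : V} (hf : IsInducedCycle G M f) (hv : ∀ k ≤ M, f k ≠ v)
    (h0 : ¬ G.Adj (f 0) v) (hM : ¬ G.Adj (f M) v) (hij : i₀ < j₀) (hj : j₀ ≤ M)
    (hi₀ : G.Adj (f i₀) v) (hj₀ : G.Adj (f j₀) v) :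
    ContainsInducedSubdivision house G ∨ ∃ n, 5 ≤ n ∧ Nonempty (longTwinWheel n ↪g G) := by
  classical
  have hex : ∃ i ≤ M, G.Adj (f i) v := ⟨i₀, by omega, hi₀⟩
  obtain ⟨hiM, hi⟩ := Nat.find_spec hex
  have hi_min : ∀ k ≤ M, G.Adj (f k) v → Nat.find hex ≤ k := fun k hk h =>
    Nat.find_min' hex ⟨hk, h⟩
  generalize Nat.find hex = i at hiM hi hi_min
  obtain ⟨j, hjM, hjv, hj_max⟩ : ∃ j ≤ M, G.Adj (f j) v ∧
      ∀ k ≤ M, G.Adj (f k) v → k ≤ j :=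
    ⟨Nat.findGreatest (fun k => G.Adj (f k) v) M, Nat.findGreatest_le M,
      Nat.findGreatest_spec (P := fun k => G.Adj (f k) v) hj hj₀,
      fun k hk h => Nat.le_findGreatest hk h⟩
  have hi_pos : 0 < i := by
    rcases Nat.eq_zero_or_pos i with rfl | h
    · exact absurd hi h0
    · exact h
  have hj_lt : j < M := by
    rcases Nat.lt_or_eq_of_le hjM with h | rfl
    · exact h
    · exact absurd hjv hM
  have hlt : i < j := by
    have := hi_min i₀ (by omega) hi₀
    have := hj_max j₀ hj hj₀
    omega
  by_cases hmid : ∃ k, i < k ∧ k < j ∧ G.Adj (f k) v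
  swap
  · left
    refine hf.containsInducedSubdivision (l := 0) (g := fun _ => v) (i := i) (j := j)
      ⟨by omega, fun s hs t ht => ?_, fun k hk _ _ => hv k hk, fun k hk t ht => ?_⟩ hlt hjM (by omega)
    · simp
      omega
    · constructor
      · intro h
        have := hi_min k hk h
        have := hj_max k hk h
        by_contra hc
        exact hmid ⟨k, by omega, by omega, h⟩
      · rintro (⟨rfl, -⟩ | ⟨rfl, -⟩)
        · exact hi
        · exact hjv
  obtain ⟨hia, haj, hav⟩ := Nat.find_spec hmid
  have ha_min : ∀ k, i < k → k < j → G.Adj (f k) v → Nat.find hmid ≤ k := fun k h1 h2 h =>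
    Nat.find_min' hmid ⟨h1, h2, h⟩
  generalize Nat.find hmid = a at hia haj hav ha_min
  by_cases hj2 : j = i + 2
  · right
    refine ⟨M + 1, by omega, hf.nonempty_longTwinWheel_embedding (i := i) (by omega) hv ?_⟩
    intro k hk
    constructor
    · intro h
      have := hi_min k hk h
      have := hj_max k hk h
      omega
    · obtain rfl : a = i + 1 := by omega
      subst hj2
      rintro (rfl | rfl | rfl) <;> assumption
  left
  let f' : ℕ → V := fun t => if t ≤ i then f t else if t = i + 1 then v else f (t - (i + 2) + j)
  have hf'1 : ∀ t ≤ i, f' t = f t := fun t ht => if_pos ht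
  have hf'2 : f' (i + 1) = v := by simp [f']
  have hf'3 : ∀ t, i + 2 ≤ t → f' t = f (t - (i + 2) + j) := fun t ht => by
    simp only [f']
    rw [if_neg (by omega), if_neg (by omega)]
  have hcase : ∀ t, t ≤ i ∨ t = i + 1 ∨ i + 2 ≤ t := by omega
  have hvadj : ∀ k ≤ M, (k ≤ i ∨ j ≤ k) → (G.Adj (f k) v ↔ k = i ∨ k = j) := by
    intro k hk hk'
    constructor
    · intro h
      have := hi_min k hk h
      have := hj_max k hk h
      omega
    · rintro (rfl | rfl) <;> assumption
  have hcyc : IsInducedCycle G (i + 2 + (M - j)) f' := by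
    refine ⟨by omega, fun s hs t ht e => ?_, fun s hs t ht => ?_⟩
    · rcases hcase s with h1 | h1 | h1 <;> rcases hcase t with h2 | h2 | h2 <;>
        simp only [hf'1, hf'2, hf'3, h1, h2] at e
      · exact hf.inj _ (by omega) _ (by omega) e
      · exact absurd e (hv _ (by omega))
      · have := hf.inj _ (by omega) _ (by omega) e
        omega
      · exact absurd e.symm (hv _ (by omega))
      · rw [h1, h2]
      · exact absurd e.symm (hv _ (by omega))
      · have := hf.inj _ (by omega) _ (by omega) e
        omega
      · exact absurd e (hv _ (by omega))
      · have := hf.inj _ (by omega) _ (by omega) e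
        omega
    · rcases hcase s with h1 | h1 | h1 <;> rcases hcase t with h2 | h2 | h2 <;>
        simp only [hf'1, hf'2, hf'3, h1, h2]
      · rw [hf.adj_iff _ (by omega) _ (by omega)]
        omega
      · rw [hvadj _ (by omega) (by omega)]
        omega
      · rw [hf.adj_iff _ (by omega) _ (by omega)]
        omega
      · rw [G.adj_comm, hvadj _ (by omega) (by omega)]
        omega
      · simp
      · rw [G.adj_comm, hvadj _ (by omega) (by omega)]
        omega
      · rw [hf.adj_iff _ (by omega) _ (by omega)]
        omega
      · rw [hvadj _ (by omega) (by omega)]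
        omega
      · rw [hf.adj_iff _ (by omega) _ (by omega)]
        omega
  by_cases haj' : a = j - 1
  · refine hcyc.containsInducedSubdivision (l := 0) (g := fun _ => f a) (i := i + 1) (j := i + 2)
      ⟨by omega, fun s hs t ht => ?_, fun k hk t ht e => ?_, fun k hk t ht => ?_⟩ (by omega)
      (by omega) (by omega)
    · simp
      omega
    · rcases hcase k with h1 | h1 | h1 <;> simp only [hf'1, hf'2, hf'3, h1] at e
      · have := hf.inj _ (by omega) _ (by omega) e
        omega
      · exact hv _ (by omega) e.symm
      · have := hf.inj _ (by omega) _ (by omega) e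
        omega
    · rcases hcase k with h1 | h1 | h1 <;> simp only [hf'1, hf'2, hf'3, h1, true_and]
      · rw [hf.adj_iff _ (by omega) _ (by omega)]
        omega
      · exact iff_of_true hav.symm (by omega)
      · rw [hf.adj_iff _ (by omega) _ (by omega)]
        omega
  · refine hcyc.containsInducedSubdivision (l := a - (i + 1)) (g := fun t => f (i + 1 + t))
      (i := i) (j := i + 1)
      ⟨fun s hs t ht e => ?_, fun s hs t ht => ?_, fun k hk t ht e => ?_, fun k hk t ht => ?_⟩
      (by omega) (by omega) (by omega)
    · have := hf.inj _ (by omega) _ (by omega) e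
      omega
    · rw [hf.adj_iff _ (by omega) _ (by omega)]
      omega
    · rcases hcase k with h1 | h1 | h1 <;> simp only [hf'1, hf'2, hf'3, h1] at e
      · have := hf.inj _ (by omega) _ (by omega) e
        omega
      · exact hv _ (by omega) e.symm
      · have := hf.inj _ (by omega) _ (by omega) e
        omega
    · rcases hcase k with h1 | h1 | h1 <;> simp only [hf'1, hf'2, hf'3, h1, true_and]
      · rw [hf.adj_iff _ (by omega) _ (by omega)]
        omega
      · constructor
        · intro h
          have := ha_min _ (by omega) (by omega) h.symm
          omega
        · intro h
          obtain rfl : t = a - (i + 1) := by omega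
          rwa [show i + 1 + (a - (i + 1)) = a by omega, G.adj_comm]
      · rw [hf.adj_iff _ (by omega) _ (by omega)]
        omega

/-! ### From an attached hole to a theta or a twin wheel -/

theorem IsAttachedHole.eq_or_eq_of_adj {V : Type} {G : SimpleGraph V} {C K : Set V}
    {p q a b x y z t : V} (h : IsAttachedHole G C K p q a b) (hx : x ∈ C) (hy : y ∈ C) (hz : z ∈ C)
    (ht : t ∈ C) (hyz : y ≠ z) (hxy : G.Adj x y) (hxz : G.Adj x z) (hxt : G.Adj x t) :
    t = y ∨ t = z := by
  obtain ⟨y', -, z', -, -, -, -, h'⟩ := h.regular x hx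
  have := h' y hy hxy
  have := h' z hz hxz
  have := h' t ht hxt
  grind

theorem IsAttachedHole.exists_adj_ne {V : Type} {G : SimpleGraph V} {C K : Set V}
    {p q a b x : V} (h : IsAttachedHole G C K p q a b) (hx : x ∈ C) (y : V) :
    ∃ z ∈ C, z ≠ y ∧ G.Adj x z := by
  obtain ⟨y', hy', z', hz', hne, hxy', hxz', -⟩ := h.regular x hx
  by_cases hy : y' = y
  · exact ⟨z', hz', fun e => hne (hy.trans e.symm), hxz'⟩
  · exact ⟨y', hy', hy, hxy'⟩

theorem IsAttachedHole.exists_isInducedCycle {V : Type} [Finite V] {G : SimpleGraph V}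
    {C K : Set V} {p q a b : V} (h : IsAttachedHole G C K p q a b) :
    ∃ M f, IsInducedCycle G M f ∧ f 0 = p ∧ f M = q ∧ ∀ x, x ∈ C ↔ ∃ k ≤ M, f k = x := by
  classical
  let P : ℕ → Prop := fun m => ∃ f : ℕ → V, f 0 = p ∧ (∀ k ≤ m, f k ∈ C) ∧ (∀ k ≤ m, f k ≠ q) ∧
    (∀ k < m, G.Adj (f k) (f (k + 1))) ∧ ∀ i ≤ m, ∀ j ≤ m, f i = f j → i = j
  have hbound : ∀ m, P m → m ≤ Nat.card V := by
    rintro m ⟨f, -, -, -, -, hinj⟩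
    have := Nat.card_le_card_of_injective (fun k : Fin (m + 1) => f k) fun i j e =>
      Fin.ext (hinj i (by omega) j (by omega) e)
    simp only [Nat.card_fin] at this
    omega
  have hP0 : P 0 := ⟨fun _ => p, rfl, fun _ _ => h.mem_p, fun _ _ => h.adj.ne, by simp, by simp⟩
  obtain ⟨m, ⟨f, hf0, hfC, hfq, hfadj, hfinj⟩, hmax⟩ : ∃ m, P m ∧ ∀ k, P k → k ≤ m :=
    ⟨Nat.findGreatest P (Nat.card V), Nat.findGreatest_spec (hbound 0 hP0) hP0,
      fun k hk => Nat.le_findGreatest (hbound k hk) hk⟩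
  have hext : ∀ w ∈ C, G.Adj (f m) w → w ≠ q → ∃ k ≤ m, f k = w := by
    intro w hw hadj hwq
    by_contra hc
    push Not at hc
    let f' : ℕ → V := fun k => if k ≤ m then f k else w
    have hf' : ∀ k ≤ m, f' k = f k := fun k hk => if_pos hk
    have hf'' : ∀ k, m < k → f' k = w := fun k hk => if_neg (by omega)
    have hP : P (m + 1) := by
      refine ⟨f', by rw [hf' 0 (by omega), hf0], fun k hk => ?_, fun k hk => ?_, fun k hk => ?_,
        fun i hi j hj e => ?_⟩
      · rcases Nat.lt_or_ge m k with h1 | h1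
        · rwa [hf'' k h1]
        · rw [hf' k h1]
          exact hfC k h1
      · rcases Nat.lt_or_ge m k with h1 | h1
        · rwa [hf'' k h1]
        · rw [hf' k h1]
          exact hfq k h1
      · rcases Nat.lt_or_ge k m with h1 | h1
        · rw [hf' k h1.le, hf' (k + 1) h1]
          exact hfadj k h1
        · obtain rfl : k = m := by omega
          rwa [hf' k le_rfl, hf'' (k + 1) (by omega)]
      · rcases Nat.lt_or_ge m i with h1 | h1 <;> rcases Nat.lt_or_ge m j with h2 | h2
        · omega
        · rw [hf'' i h1, hf' j h2] at e
          exact absurd e.symm (hc j h2)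
        · rw [hf' i h1, hf'' j h2] at e
          exact absurd e (hc i h1)
        · rw [hf' i h1, hf' j h2] at e
          exact hfinj i h1 j h2 e
    have := hmax _ hP
    omega
  have hm : 0 < m := by
    rcases Nat.eq_zero_or_pos m with rfl | hm
    · obtain ⟨z, hz, hzq, hpz⟩ := h.exists_adj_ne h.mem_p q
      obtain ⟨k, hk, rfl⟩ := hext z hz (hf0 ▸ hpz) hzq
      obtain rfl : k = 0 := by omega
      exact absurd hf0.symm hpz.ne
    · exact hm
  have hmq : G.Adj (f m) q := by
    obtain ⟨w, hw, hwm, hadj⟩ := h.exists_adj_ne (hfC m le_rfl) (f (m - 1))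
    by_contra hc
    have hwq : w ≠ q := by
      rintro rfl
      exact hc hadj
    obtain ⟨k, hk, rfl⟩ := hext w hw hadj hwq
    have hkm : k ≠ m := by
      rintro rfl
      exact hadj.ne rfl
    have hkm' : k ≠ m - 1 := by
      rintro rfl
      exact hwm rfl
    rcases Nat.eq_zero_or_pos k with rfl | hk0
    · have := h.eq_or_eq_of_adj (x := f 0) (y := f 1) (z := q) (t := f m) (hfC 0 hk)
        (hfC 1 (by omega)) h.mem_q (hfC m le_rfl) (hfq 1 (by omega)) (hfadj 0 hm)
        (hf0 ▸ h.adj) hadj.symm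
      rcases this with e | e
      · have := hfinj _ le_rfl _ (by omega) e
        omega
      · exact hfq m le_rfl e
    · have h1 := hfadj (k - 1) (by omega)
      rw [Nat.sub_add_cancel hk0] at h1
      have := h.eq_or_eq_of_adj (x := f k) (y := f (k - 1)) (z := f (k + 1)) (t := f m) (hfC k hk)
        (hfC _ (by omega)) (hfC _ (by omega)) (hfC m le_rfl) (fun e => ?_) h1.symm
        (hfadj k (by omega)) hadj.symm
      · rcases this with e | e
        · have := hfinj _ le_rfl _ (by omega) e
          omega
        · have := hfinj _ le_rfl _ (by omega) e
          omega
      · have := hfinj _ (by omega) _ (by omega) e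
        omega
  let f' : ℕ → V := fun k => if k ≤ m then f k else q
  have hf' : ∀ k ≤ m, f' k = f k := fun k hk => if_pos hk
  have hf'' : f' (m + 1) = q := if_neg (by omega)
  have hC' : ∀ k ≤ m + 1, f' k ∈ C := by
    intro k hk
    rcases Nat.lt_or_ge m k with h1 | h1
    · obtain rfl : k = m + 1 := by omega
      exact hf'' ▸ h.mem_q
    · rw [hf' k h1]
      exact hfC k h1
  have hadj' : ∀ k ≤ m, G.Adj (f' k) (f' (k + 1)) := by
    intro k hk
    rcases Nat.lt_or_ge k m with h1 | h1
    · rw [hf' k hk, hf' (k + 1) h1]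
      exact hfadj k h1
    · obtain rfl : k = m := by omega
      rwa [hf' k hk, hf'']
  have hlast : G.Adj (f' 0) (f' (m + 1)) := by
    rw [hf' 0 (by omega), hf'', hf0]
    exact h.adj
  have hinj' : ∀ i ≤ m + 1, ∀ j ≤ m + 1, f' i = f' j → i = j := by
    intro i hi j hj e
    rcases Nat.lt_or_ge m i with h1 | h1 <;> rcases Nat.lt_or_ge m j with h2 | h2
    · omega
    · obtain rfl : i = m + 1 := by omega
      rw [hf'', hf' j h2] at e
      exact absurd e.symm (hfq j h2)
    · obtain rfl : j = m + 1 := by omega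
      rw [hf' i h1, hf''] at e
      exact absurd e (hfq i h1)
    · rw [hf' i h1, hf' j h2] at e
      exact hfinj i h1 j h2 e
  have hnbr : ∀ i ≤ m + 1, ∃ s ≤ m + 1, ∃ t ≤ m + 1, s ≠ t ∧ G.Adj (f' i) (f' s) ∧
      G.Adj (f' i) (f' t) ∧ ∀ j ≤ m + 1, (j = s ∨ j = t ↔
        j = i + 1 ∨ i = j + 1 ∨ (i = 0 ∧ j = m + 1) ∨ (j = 0 ∧ i = m + 1)) := by
    intro i hi
    rcases Nat.eq_zero_or_pos i with rfl | hi0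
    · exact ⟨1, by omega, m + 1, le_rfl, by omega, hadj' 0 (by omega), hlast, by omega⟩
    have h1 := hadj' (i - 1) (by omega)
    rw [Nat.sub_add_cancel hi0] at h1
    rcases Nat.lt_or_ge m i with h2 | h2
    · obtain rfl : i = m + 1 := by omega
      exact ⟨m + 1 - 1, by omega, 0, by omega, by omega, h1.symm, hlast.symm, by omega⟩
    · exact ⟨i - 1, by omega, i + 1, by omega, by omega, h1.symm, hadj' i h2, by omega⟩
  have hnbr' : ∀ i ≤ m + 1, ∀ t ∈ C, G.Adj (f' i) t → ∃ j ≤ m + 1, f' j = t ∧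
      (j = i + 1 ∨ i = j + 1 ∨ (i = 0 ∧ j = m + 1) ∨ (j = 0 ∧ i = m + 1)) := by
    intro i hi t ht hit
    obtain ⟨s, hs, r, hr, hsr, h1, h2, h3⟩ := hnbr i hi
    rcases h.eq_or_eq_of_adj (hC' i hi) (hC' s hs) (hC' r hr) ht
      (fun e => hsr (hinj' s hs r hr e)) h1 h2 hit with rfl | rfl
    · exact ⟨s, hs, rfl, (h3 s hs).1 (Or.inl rfl)⟩
    · exact ⟨r, hr, rfl, (h3 r hr).1 (Or.inr rfl)⟩
  refine ⟨m + 1, f', ⟨by omega, hinj', fun i hi j hj => ⟨fun hij => ?_, fun hij => ?_⟩⟩, ?_, hf'',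
    fun x => ⟨fun hx => ?_, ?_⟩⟩
  · obtain ⟨k, hk, e, h1⟩ := hnbr' i hi _ (hC' j hj) hij
    rwa [hinj' k hk j hj e] at h1
  · obtain ⟨s, hs, r, hr, -, h1, h2, h3⟩ := hnbr i hi
    rcases (h3 j hj).2 hij with rfl | rfl
    · exact h1
    · exact h2
  · rw [hf' 0 (by omega), hf0]
  · refine h.conn.2 {x | ∃ k ≤ m + 1, f' k = x} ⟨_, h.mem_q, m + 1, le_rfl, hf''⟩ ?_ hx
    rintro _ _ ⟨k, hk, rfl⟩ t ht hkt
    obtain ⟨j, hj, e, -⟩ := hnbr' k hk t ht hkt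
    exact ⟨j, hj, e⟩
  · rintro ⟨k, hk, rfl⟩
    exact hC' k hk

/-- `g 0, …, g l` is a walk avoiding `f 0, …, f M` and the neighbors of `f 0` and `f M`, whose ends
are adjacent to `f i` and `f j` respectively. -/
structure IsWalkEar {V : Type} (G : SimpleGraph V) (M : ℕ) (f : ℕ → V) (l : ℕ) (g : ℕ → V)
    (i j : ℕ) : Prop where
  disjoint : ∀ k ≤ M, ∀ t ≤ l, f k ≠ g t
  not_adj_first : ∀ t ≤ l, ¬ G.Adj (f 0) (g t)
  not_adj_last : ∀ t ≤ l, ¬ G.Adj (f M) (g t)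
  adj : ∀ t < l, G.Adj (g t) (g (t + 1))
  left_le : i ≤ M
  right_le : j ≤ M
  ne : i ≠ j
  adj_left : G.Adj (f i) (g 0)
  adj_right : G.Adj (f j) (g l)

theorem IsWalkEar.isInducedEar {V : Type} {G : SimpleGraph V} {M l i j : ℕ} {f g : ℕ → V}
    (h : IsWalkEar G M f l g i j) (hl : 0 < l)
    (hmin : ∀ l' g' i' j', IsWalkEar G M f l' g' i' j' → l ≤ l') : IsInducedEar G M f l g i j := by
  have hshift : ∀ s d, s + d ≤ l → 0 < d →
      (s + d < l → G.Adj (g s) (g (s + d + 1))) → (s + d = l → g s = g l) → False := by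
    intro s d hsd hd hadj hend
    let g' : ℕ → V := fun t => if t ≤ s then g t else g (t + d)
    have hg' : ∀ t, t ≤ s → g' t = g t := fun t ht => if_pos ht
    have hg'' : ∀ t, s < t → g' t = g (t + d) := fun t ht => if_neg (by omega)
    have hval : ∀ t ≤ l - d, ∃ r ≤ l, g' t = g r := by
      intro t ht
      rcases Nat.lt_or_ge s t with h1 | h1
      · exact ⟨t + d, by omega, hg'' t h1⟩
      · exact ⟨t, by omega, hg' t h1⟩
    have := hmin (l - d) g' i j
      { disjoint := fun k hk t ht => by
          obtain ⟨r, hr, e⟩ := hval t ht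
          rw [e]
          exact h.disjoint k hk r hr
        not_adj_first := fun t ht => by
          obtain ⟨r, hr, e⟩ := hval t ht
          rw [e]
          exact h.not_adj_first r hr
        not_adj_last := fun t ht => by
          obtain ⟨r, hr, e⟩ := hval t ht
          rw [e]
          exact h.not_adj_last r hr
        adj := fun t ht => by
          rcases Nat.lt_trichotomy t s with h1 | rfl | h1
          · rw [hg' t h1.le, hg' (t + 1) h1]
            exact h.adj t (by omega)
          · rw [hg' t le_rfl, hg'' (t + 1) (by omega), Nat.add_right_comm]
            exact hadj (by omega)
          · rw [hg'' t h1, hg'' (t + 1) (by omega), Nat.add_right_comm]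
            exact h.adj (t + d) (by omega)
        left_le := h.left_le
        right_le := h.right_le
        ne := h.ne
        adj_left := by
          rw [hg' 0 (by omega)]
          exact h.adj_left
        adj_right := by
          rcases Nat.lt_or_ge s (l - d) with h1 | h1
          · rw [hg'' _ h1, Nat.sub_add_cancel (by omega)]
            exact h.adj_right
          · obtain rfl : l - d = s := by omega
            rw [hg' _ le_rfl, hend (by omega)]
            exact h.adj_right }
    omega
  have hnadj : ∀ s t, s + 1 < t → t ≤ l → ¬ G.Adj (g s) (g t) := by
    intro s t hst ht hadj
    refine hshift s (t - s - 1) (by omega) (by omega) (fun _ => ?_) (by omega)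
    rwa [show s + (t - s - 1) + 1 = t by omega]
  have hne : ∀ s t, s < t → t ≤ l → g s ≠ g t := by
    intro s t hst ht e
    refine hshift s (t - s) (by omega) (by omega) (fun h1 => ?_) (fun h1 => ?_)
    · rw [show s + (t - s) = t by omega, e]
      exact h.adj t (by omega)
    · rw [e, show t = l by omega]
  have hleft : ∀ k ≤ M, ∀ t < l, G.Adj (f k) (g t) → k = i := by
    intro k hk t ht hadj
    by_contra hc
    have := hmin t g i k
      { disjoint := fun k hk s hs => h.disjoint k hk s (by omega)
        not_adj_first := fun s hs => h.not_adj_first s (by omega)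
        not_adj_last := fun s hs => h.not_adj_last s (by omega)
        adj := fun s hs => h.adj s (by omega)
        left_le := h.left_le
        right_le := hk
        ne := fun e => hc e.symm
        adj_left := h.adj_left
        adj_right := hadj }
    omega
  have hright : ∀ k ≤ M, ∀ t ≤ l, 0 < t → G.Adj (f k) (g t) → k = j := by
    intro k hk t ht ht0 hadj
    by_contra hc
    have := hmin (l - t) (fun s => g (s + t)) k j
      { disjoint := fun k hk s hs => h.disjoint k hk _ (by omega)
        not_adj_first := fun s hs => h.not_adj_first _ (by omega)
        not_adj_last := fun s hs => h.not_adj_last _ (by omega)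
        adj := fun s hs => by
          rw [Nat.add_right_comm]
          exact h.adj (s + t) (by omega)
        left_le := hk
        right_le := h.right_le
        ne := hc
        adj_left := by rwa [Nat.zero_add]
        adj_right := by
          rw [Nat.sub_add_cancel ht]
          exact h.adj_right }
    omega
  refine ⟨fun s hs t ht e => ?_, fun s hs t ht => ⟨fun hadj => ?_, ?_⟩, h.disjoint,
    fun k hk t ht => ⟨fun hadj => ?_, ?_⟩⟩
  · rcases Nat.lt_trichotomy s t with h1 | h1 | h1
    · exact absurd e (hne s t h1 ht)
    · exact h1
    · exact absurd e.symm (hne t s h1 hs)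
  · by_contra hc
    have hst : s ≠ t := by
      rintro rfl
      exact hadj.ne rfl
    rcases Nat.lt_or_gt_of_ne hst with h1 | h1
    · exact hnadj s t (by omega) ht hadj
    · exact hnadj t s (by omega) hs hadj.symm
  · rintro (rfl | rfl)
    · exact h.adj s (by omega)
    · exact (h.adj t (by omega)).symm
  · have hij := h.ne
    have h1 := hleft k hk t
    have h2 := hright k hk t ht
    rcases Nat.eq_zero_or_pos t with rfl | h0
    · exact Or.inl ⟨h1 hl hadj, rfl⟩
    · have hkj := h2 h0 hadj
      refine Or.inr ⟨hkj, ?_⟩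
      by_contra hc
      exact hij ((h1 (by omega) hadj).symm.trans hkj)
  · rintro (⟨rfl, rfl⟩ | ⟨rfl, rfl⟩)
    · exact h.adj_left
    · exact h.adj_right

theorem HasAttachedHole.subdivision_or_twinWheel {V : Type} [Finite V] {G : SimpleGraph V}
    (h : HasAttachedHole G) :
    ContainsInducedSubdivision house G ∨ ∃ n, 5 ≤ n ∧ Nonempty (longTwinWheel n ↪g G) := by
  classical
  obtain ⟨C, K, p, q, a, b, h⟩ := h
  obtain ⟨M, f, hf, hf0, hfM, hfC⟩ := h.exists_isInducedCycle
  have hex : ∃ l g i j, IsWalkEar G M f l g i j := by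
    obtain ⟨x, hx, hax⟩ := h.adj_a
    obtain ⟨y, hy, hby⟩ := h.adj_b
    obtain ⟨i, hi, rfl⟩ := (hfC a).1 h.mem_a
    obtain ⟨j, hj, rfl⟩ := (hfC b).1 h.mem_b
    obtain ⟨l, g, rfl, rfl, hgK, hg⟩ := h.conn_right.exists_seq hx hy
    exact ⟨l, g, i, j, fun k hk t ht e => h.disjoint _ ((hfC _).2 ⟨k, hk, rfl⟩) (e ▸ hgK t ht),
      fun t ht => hf0 ▸ h.not_adj_p _ (hgK t ht), fun t ht => hfM ▸ h.not_adj_q _ (hgK t ht), hg,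
      hi, hj, fun e => h.ne (e ▸ rfl), hax, hby⟩
  obtain ⟨g, i, j, hg⟩ := Nat.find_spec hex
  have hmin : ∀ l' g' i' j', IsWalkEar G M f l' g' i' j' → Nat.find hex ≤ l' :=
    fun l' g' i' j' h => Nat.find_min' hex ⟨g', i', j', h⟩
  generalize Nat.find hex = l at hg hmin
  rcases Nat.eq_zero_or_pos l with rfl | hl
  · have hd : ∀ k ≤ M, f k ≠ g 0 := fun k hk => hg.disjoint k hk 0 le_rfl
    rcases Nat.lt_or_gt_of_ne hg.ne with hij | hij
    · exact hf.subdivision_or_twinWheel_of_vertex hd (hg.not_adj_first 0 le_rfl)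
        (hg.not_adj_last 0 le_rfl) hij hg.right_le hg.adj_left hg.adj_right
    · exact hf.subdivision_or_twinWheel_of_vertex hd (hg.not_adj_first 0 le_rfl)
        (hg.not_adj_last 0 le_rfl) hij hg.left_le hg.adj_right hg.adj_left
  · left
    have hear := hg.isInducedEar hl hmin
    have hM := hf.two_le
    have hi0 : i ≠ 0 := by
      rintro rfl
      exact hg.not_adj_first 0 (by omega) hg.adj_left
    have hj0 : j ≠ 0 := by
      rintro rfl
      exact hg.not_adj_first l le_rfl hg.adj_right
    have hiM : i ≠ M := by
      rintro rfl
      exact hg.not_adj_last 0 (by omega) hg.adj_left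
    have hjM : j ≠ M := by
      rintro rfl
      exact hg.not_adj_last l le_rfl hg.adj_right
    have hi := hg.left_le
    have hj := hg.right_le
    rcases Nat.lt_or_gt_of_ne hg.ne with hij | hij
    · exact hf.containsInducedSubdivision hear hij hj (by omega)
    · exact hf.containsInducedSubdivision hear.reverse hij hi (by omega)


theorem house_induced_minor_free_iff {V : Type} [Fintype V] (G : SimpleGraph V) :
    ¬ InducedMinor house G ↔
      (¬ ContainsInducedSubdivision house G ∧
        ¬ ∃ n : ℕ, 5 ≤ n ∧ Nonempty (longTwinWheel n ↪g G)) := by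
  constructor
  · intro h
    refine ⟨?_, ?_⟩
    · rintro ⟨B, H', hH, ⟨e⟩⟩
      exact h (hH.inducedMinor.of_embedding e)
    · rintro ⟨n, hn, ⟨e⟩⟩
      exact h ((longTwinWheel_inducedMinor_house hn).of_embedding e)
  · rintro ⟨h1, h2⟩ h
    exact (hasAttachedHole_of_inducedMinor h).subdivision_or_twinWheel.elim h1 h2
end

section
/- A finite simple graph G contains the butterfly as an induced minor if and only if there exists a vertex set X ⊆ V(G) inducing a subgraph isomorphic to 2P_2 and a connected component C of the graph G − X such that every vertex in X has a neighbor in C. -/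
open SimpleGraph

namespace SimpleGraph

variable {V : Type} {G : SimpleGraph V}

/-- Vertices of a connected set `D ⊆ S` lie in the same component of `G.induce S`. -/
theorem reachable_induce_of_connected_subset {D S : Set V} (hD : (G.induce D).Connected)
    (hDS : D ⊆ S) {x y : V} (hx : x ∈ D) (hy : y ∈ D) :
    (G.induce S).Reachable ⟨x, hDS hx⟩ ⟨y, hDS hy⟩ :=
  (hD ⟨x, hx⟩ ⟨y, hy⟩).map (induceHomOfLE G hDS).toHom

theorem connected_induce_image_supp {S : Set V} (C : (G.induce S).ConnectedComponent) :
    (G.induce (Subtype.val '' C.supp)).Connected :=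
  C.connected_toSimpleGraph.map
    (f := ⟨fun v ↦ ⟨v.1.1, v.1, v.2, rfl⟩, fun h ↦ h⟩)
    (by rintro ⟨_, w, hw, rfl⟩; exact ⟨⟨w, hw⟩, rfl⟩)

theorem connected_induce_singleton (v : V) : (G.induce {v}).Connected := by
  rw [connected_iff]
  exact ⟨.of_subsingleton, ⟨⟨v, rfl⟩⟩⟩

/-- If a connected set `A` contains two distinct neighbours of a connected set `Z`, then `Z` can be
enlarged inside `Z ∪ A` to a connected set seeing both ends of some edge of `G.induce A` that it
avoids. -/
theorem exists_edge_with_neighbors_in_connected {A Z : Set V} (hA : (G.induce A).Connected)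
    (hZ : (G.induce Z).Connected) (hAZ : Disjoint A Z) {x y z w : V} (hxA : x ∈ A) (hyA : y ∈ A)
    (hxy : x ≠ y) (hz : z ∈ Z) (hw : w ∈ Z) (hxz : G.Adj x z) (hyw : G.Adj y w) :
    ∃ a ∈ A, ∃ b ∈ A, G.Adj a b ∧ ∃ Z' : Set V, Z ⊆ Z' ∧ Z' ⊆ Z ∪ A ∧
      (G.induce Z').Connected ∧ a ∉ Z' ∧ b ∉ Z' ∧ (∃ c ∈ Z', G.Adj a c) ∧
      ∃ c ∈ Z', G.Adj b c := by
  obtain ⟨p, hp, hpA⟩ : ∃ p : G.Walk x y, p.IsPath ∧ ∀ v ∈ p.support, v ∈ A := by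
    obtain ⟨p, hp⟩ := hA.exists_isPath ⟨x, hxA⟩ ⟨y, hyA⟩
    refine ⟨p.map (Embedding.induce A).toHom, hp.map Subtype.val_injective, fun v hv ↦ ?_⟩
    obtain ⟨u, -, rfl⟩ := List.mem_map.1 (Walk.support_map .. ▸ hv)
    exact u.2
  have hnot {v : V} (hv : v ∈ A) : v ∉ Z := hAZ.notMem_of_mem_left hv
  cases p with
  | nil => exact absurd rfl hxy
  | @cons _ b _ hxb q =>
    cases q with
    | nil =>
      exact ⟨x, hxA, y, hyA, hxb, Z, subset_rfl, Set.subset_union_left, hZ, hnot hxA, hnot hyA,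
        ⟨z, hz, hxz⟩, w, hw, hyw⟩
    | @cons _ c _ hbc r =>
      have hbA : b ∈ A := hpA b (by simp)
      simp only [Walk.cons_isPath_iff, Walk.support_cons, List.mem_cons, not_or] at hp
      refine ⟨x, hxA, b, hbA, hxb, Z ∪ {v | v ∈ r.support}, Set.subset_union_left,
        Set.union_subset_union_right _ fun v hv ↦ hpA v (by simp_all), ?_, ?_, ?_,
        ⟨z, .inl hz, hxz⟩, c, .inr r.start_mem_support, hbc⟩
      · exact connected_induce_union hZ.preconnected r.connected_induce_support.preconnected hw
          r.end_mem_support hyw.symm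
      · exact fun h ↦ h.elim (hnot hxA) hp.2.2
      · exact fun h ↦ h.elim (hnot hbA) hp.1.2

end SimpleGraph

theorem butterfly_adj_zero_succ (i : Fin 4) : butterfly.Adj 0 i.succ := by
  revert i; simp only [butterfly, fromRel_adj]; decide

theorem butterfly_adj_succ_succ (i j : Fin 4) :
    butterfly.Adj i.succ j.succ ↔ twoP2.Adj i j := by
  revert i j; simp only [butterfly, twoP2, fromRel_adj]; decide

/-- Two anticomplete edges `ab` and `cd` induce a copy of `2P₂`. -/
theorem nonempty_twoP2_iso_induce {V : Type} {G : SimpleGraph V} {a b c d : V} (hab : G.Adj a b)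
    (hcd : G.Adj c d) (hac : a ≠ c) (had : a ≠ d) (hbc : b ≠ c) (hbd : b ≠ d)
    (nac : ¬ G.Adj a c) (nad : ¬ G.Adj a d) (nbc : ¬ G.Adj b c) (nbd : ¬ G.Adj b d) :
    Nonempty (twoP2 ≃g G.induce {a, b, c, d}) := by
  let f : twoP2 ↪g G :=
    { toFun := ![a, b, c, d]
      inj' := by
        intro i j
        fin_cases i <;> fin_cases j <;>
          simp [hab.ne, hab.ne', hcd.ne, hcd.ne', hac, had, hbc, hbd, hac.symm, had.symm, hbc.symm,
            hbd.symm]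
      map_rel_iff' := by
        intro i j
        change G.Adj (![a, b, c, d] i) (![a, b, c, d] j) ↔ _
        fin_cases i <;> fin_cases j <;>
          simp [twoP2, hab, hcd, hab.symm, hcd.symm, nac, nad, nbc, nbd, G.adj_comm c, G.adj_comm d] }
  have hf : Set.range f = {a, b, c, d} := by
    ext v
    change (∃ i, ![a, b, c, d] i = v) ↔ _
    simp [Fin.exists_fin_succ, eq_comm]
  exact hf ▸ ⟨f.isoInduceRange⟩

theorem InducedMinor.exists_twoP2_of_butterfly {V : Type} {G : SimpleGraph V}
    (h : InducedMinor butterfly G) :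
    ∃ X : Set V, Nonempty (twoP2 ≃g G.induce X) ∧
      ∃ C : (G.induce Xᶜ).ConnectedComponent,
        ∀ x ∈ X, ∃ y : ↥(Xᶜ), (G.induce Xᶜ).connectedComponentMk y = C ∧ G.Adj x ↑y := by
  obtain ⟨B, hne, hconn, hdisj, hadj, hnadj⟩ := h
  have center (i : Fin 4) : ∃ x ∈ B i.succ, ∃ z ∈ B 0, G.Adj x z := by
    obtain ⟨z, hz, x, hx, hzx⟩ := hadj 0 i.succ (butterfly_adj_zero_succ i)
    exact ⟨x, hx, z, hz, hzx.symm⟩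
  have dis {i j : Fin 5} (hij : i ≠ j) : Disjoint (B i) (B j) := hdisj hij
  have pair {i j : Fin 4} (hij : twoP2.Adj i j) :
      (G.induce (B i.succ ∪ B j.succ)).Connected := by
    obtain ⟨u, hu, v, hv, huv⟩ := hadj _ _ ((butterfly_adj_succ_succ i j).2 hij)
    exact connected_induce_union (hconn _).preconnected (hconn _).preconnected hu hv huv
  have anti {x y : V} (hx : x ∈ B 1 ∪ B 2) (hy : y ∈ B 3 ∪ B 4) : ¬ G.Adj x y ∧ x ≠ y := by
    have aux {i j : Fin 5} (hij : i ≠ j) (hn : ¬ butterfly.Adj i j) (hi : x ∈ B i) (hj : y ∈ B j) :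
        ¬ G.Adj x y ∧ x ≠ y :=
      ⟨hnadj i j hij hn x hi y hj, (dis hij).ne_of_mem hi hj⟩
    rcases hx with hx | hx <;> rcases hy with hy | hy <;>
      exact aux (by decide) (by simp only [butterfly, fromRel_adj]; decide) hx hy
  obtain ⟨x₁, hx₁, z₁, hz₁, h₁⟩ := center 0
  obtain ⟨x₂, hx₂, z₂, hz₂, h₂⟩ := center 1
  obtain ⟨x₃, hx₃, z₃, hz₃, h₃⟩ := center 2
  obtain ⟨x₄, hx₄, z₄, hz₄, h₄⟩ := center 3
  have hdisj₁ : Disjoint (B 1 ∪ B 2) (B 0) :=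
    (dis (by decide)).union_left (dis (by decide))
  have hdisj₂ : Disjoint (B 3 ∪ B 4) (B 0) :=
    (dis (by decide)).union_left (dis (by decide))
  obtain ⟨a, ha, b, hb, hab, Z, hZ, hZB, hZc, haZ, hbZ, ⟨a', ha', haa'⟩, b', hb', hbb'⟩ :=
    exists_edge_with_neighbors_in_connected (pair (i := 0) (j := 1) (by simp [twoP2])) (hconn 0)
      hdisj₁ (.inl hx₁) (.inr hx₂) ((dis (by decide)).ne_of_mem hx₁ hx₂) hz₁ hz₂ h₁ h₂
  have hdisjZ : Disjoint (B 3 ∪ B 4) Z :=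
    (hdisj₂.union_right (Set.disjoint_left.2 fun y hy hy' ↦ (anti hy' hy).2 rfl)).mono_right hZB
  obtain ⟨c, hc, d, hd, hcd, Y, hZY, hYZ, hYc, hcY, hdY, ⟨c', hc', hcc'⟩, d', hd', hdd'⟩ :=
    exists_edge_with_neighbors_in_connected (pair (i := 2) (j := 3) (by simp [twoP2])) hZc
      hdisjZ (.inl hx₃) (.inr hx₄) ((dis (by decide)).ne_of_mem hx₃ hx₄) (hZ hz₃) (hZ hz₄) h₃ h₄
  have notMemY {v : V} (hv : v ∈ B 1 ∪ B 2) (hvZ : v ∉ Z) : v ∉ Y := fun h ↦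
    (hYZ h).elim hvZ fun h' ↦ (anti hv h').2 rfl
  have hYX : Y ⊆ ({a, b, c, d} : Set V)ᶜ := by
    rintro y hy (rfl | rfl | rfl | rfl)
    exacts [notMemY ha haZ hy, notMemY hb hbZ hy, hcY hy, hdY hy]
  refine ⟨{a, b, c, d}, nonempty_twoP2_iso_induce hab hcd (anti ha hc).2 (anti ha hd).2
    (anti hb hc).2 (anti hb hd).2 (anti ha hc).1 (anti ha hd).1 (anti hb hc).1 (anti hb hd).1,
    (G.induce _).connectedComponentMk ⟨c', hYX hc'⟩, fun x hx ↦ ?_⟩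
  obtain ⟨y, hy, hxy⟩ : ∃ y ∈ Y, G.Adj x y := by
    rcases hx with rfl | rfl | rfl | rfl
    exacts [⟨a', hZY ha', haa'⟩, ⟨b', hZY hb', hbb'⟩, ⟨c', hc', hcc'⟩, ⟨d', hd', hdd'⟩]
  exact ⟨⟨y, hYX hy⟩,
    ConnectedComponent.sound (reachable_induce_of_connected_subset hYc hYX hy hc'), hxy⟩

theorem inducedMinor_butterfly_of_twoP2 {V : Type} {G : SimpleGraph V} {X : Set V}
    (φ : twoP2 ≃g G.induce X) (C : (G.induce Xᶜ).ConnectedComponent)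
    (hC : ∀ x ∈ X, ∃ y : ↥(Xᶜ), (G.induce Xᶜ).connectedComponentMk y = C ∧ G.Adj x ↑y) :
    InducedMinor butterfly G := by
  have hCX {v : V} (hv : v ∈ Subtype.val '' C.supp) : v ∉ X := by
    obtain ⟨u, -, rfl⟩ := hv
    exact u.2
  have center (i : Fin 4) : ∃ z ∈ Subtype.val '' C.supp, G.Adj (φ i) z := by
    obtain ⟨y, hy, h⟩ := hC _ (φ i).2
    exact ⟨y, ⟨y, hy, rfl⟩, h⟩
  refine ⟨Fin.cons (Subtype.val '' C.supp) fun i ↦ {(φ i : V)}, fun w ↦ ?_, fun w ↦ ?_,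
    fun u w huw ↦ ?_, fun u w huw ↦ ?_, fun u w huw hn ↦ ?_⟩
  · cases w using Fin.cases with
    | zero => exact C.nonempty_supp.image _
    | succ i => exact Set.singleton_nonempty _
  · cases w using Fin.cases with
    | zero => exact connected_induce_image_supp C
    | succ i => exact connected_induce_singleton _
  · cases u using Fin.cases with
    | zero =>
      cases w using Fin.cases with
      | zero => exact absurd rfl huw
      | succ j => exact Set.disjoint_singleton_right.2 fun h ↦ hCX h (φ j).2
    | succ i =>
      cases w using Fin.cases with
      | zero => exact Set.disjoint_singleton_left.2 fun h ↦ hCX h (φ i).2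
      | succ j =>
        exact Set.disjoint_singleton.2 fun h ↦
          huw (congrArg Fin.succ (φ.injective (Subtype.ext h)))
  · cases u using Fin.cases with
    | zero =>
      cases w using Fin.cases with
      | zero => exact absurd huw (butterfly.irrefl)
      | succ j =>
        obtain ⟨z, hz, h⟩ := center j
        exact ⟨z, hz, _, rfl, h.symm⟩
    | succ i =>
      cases w using Fin.cases with
      | zero =>
        obtain ⟨z, hz, h⟩ := center i
        exact ⟨_, rfl, z, hz, h⟩
      | succ j =>
        exact ⟨_, rfl, _, rfl, φ.map_rel_iff.2 ((butterfly_adj_succ_succ i j).1 huw)⟩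
  · cases u using Fin.cases with
    | zero =>
      cases w using Fin.cases with
      | zero => exact absurd rfl huw
      | succ j => exact absurd (butterfly_adj_zero_succ j) hn
    | succ i =>
      cases w using Fin.cases with
      | zero => exact absurd (butterfly_adj_zero_succ i).symm hn
      | succ j =>
        rintro _ rfl _ rfl h
        exact hn ((butterfly_adj_succ_succ i j).2 (φ.map_rel_iff.1 h))

theorem butterfly_induced_minor_iff {V : Type} [Fintype V] (G : SimpleGraph V) :
    InducedMinor butterfly G ↔
      ∃ X : Set V, Nonempty (twoP2 ≃g G.induce X) ∧
        ∃ C : (G.induce Xᶜ).ConnectedComponent,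
          ∀ x ∈ X, ∃ y : ↥(Xᶜ), (G.induce Xᶜ).connectedComponentMk y = C ∧ G.Adj x ↑y :=
  ⟨InducedMinor.exists_twoP2_of_butterfly,
    fun ⟨_, ⟨φ⟩, C, hC⟩ ↦ inducedMinor_butterfly_of_twoP2 φ C hC⟩
end
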